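/- Let δ ≥ 1, let N be an admissible norm with constant C_N, and let H_p, H_q be proper, geodesically complete, δ-hyperbolic, Busemann spaces. Set C₀ = (2853δC_N + 2^{851})². Let x = (x_p,x_q), y = (y_p,y_q) ∈ H = H_p⋈H_q and let α be a geodesic segment of (H, d_{H,N}) from x to y. Then there exist two vertical geodesics V₁ = (V_{1,p}, V_{1,q}) and V₂ = (V_{2,p}, V_{2,q}) of H such that: (1) if h(x) ≤ h(y) − 7C₀, then α lies in the 196C₀C_N-neighbourhood of V₁ ∪ (V_{1,p}, V_{2,q}) ∪ V₂; (2) if h(x) ≥ h(y) + 7C₀, then α lies in the 196C₀C_N-neighbourhood of V₁ ∪ (V_{2,p}, V_{1,q}) ∪ V₂; (3) if |h(x) − h(y)| ≤ 7C₀, then at least one of the conclusions of (1) or (2) holds. -/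

import Mathlib

open Set Filter
open scoped ENNReal NNReal

noncomputable section

namespace HP

variable {H : Type*} [MetricSpace H]

/-- `γ` restricted to `I` is an arclength-parametrised (isometric) geodesic. -/
def IsGeodesicOn (γ : ℝ → H) (I : Set ℝ) : Prop :=
  ∀ s ∈ I, ∀ t ∈ I, dist (γ s) (γ t) = |s - t|

/-- A geodesic line of `H`. -/
def IsGeodesicLine (γ : ℝ → H) : Prop := IsGeodesicOn γ Set.univ

/-- A geodesic ray of `H`, parametrised on `[0,∞)`. -/
def IsGeodesicRay (γ : ℝ → H) : Prop := IsGeodesicOn γ (Set.Ici 0)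

/-- A geodesic ray starting at `w`. -/
def IsRayFrom (w : H) (γ : ℝ → H) : Prop := IsGeodesicRay γ ∧ γ 0 = w

/-- A geodesic segment from `x` to `y`, parametrised on `[0, dist x y]`. -/
def IsGeodSegment (γ : ℝ → H) (x y : H) : Prop :=
  IsGeodesicOn γ (Set.Icc 0 (dist x y)) ∧ γ 0 = x ∧ γ (dist x y) = y

/-- The traces on `[0,∞)` of two rays are at finite Hausdorff distance. -/
def FinHausRays (γ₁ γ₂ : ℝ → H) : Prop :=
  ∃ C : ℝ, (∀ s : ℝ, 0 ≤ s → ∃ t : ℝ, 0 ≤ t ∧ dist (γ₁ s) (γ₂ t) ≤ C) ∧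
           (∀ t : ℝ, 0 ≤ t → ∃ s : ℝ, 0 ≤ s ∧ dist (γ₁ s) (γ₂ t) ≤ C)

/-- A geodesic metric space: any two points are joined by a geodesic segment. -/
def GeodesicSpace (H : Type*) [MetricSpace H] : Prop :=
  ∀ x y : H, ∃ γ : ℝ → H, IsGeodSegment γ x y

/-- `δ`-hyperbolicity: geodesic space all of whose geodesic triangles are `δ`-slim,
i.e. each side is contained in the `δ`-neighbourhood of the union of the other two. -/
def DeltaHyperbolic (H : Type*) [MetricSpace H] (δ : ℝ) : Prop :=
  GeodesicSpace H ∧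
  ∀ x y z : H, ∀ γ₁ γ₂ γ₃ : ℝ → H,
    IsGeodSegment γ₁ x y → IsGeodSegment γ₂ y z → IsGeodSegment γ₃ z x →
    ∀ s ∈ Set.Icc (0:ℝ) (dist x y),
      ∃ u ∈ γ₂ '' Set.Icc (0:ℝ) (dist y z) ∪ γ₃ '' Set.Icc (0:ℝ) (dist z x),
        dist (γ₁ s) u ≤ δ

/-- A Busemann space: geodesic, and the distance between any two
arclength-parametrised geodesics is a convex function. -/
def BusemannSpace (H : Type*) [MetricSpace H] : Prop :=
  GeodesicSpace H ∧
  ∀ (a b a' b' : ℝ) (γ γ' : ℝ → H),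
    IsGeodesicOn γ (Set.Icc a b) → IsGeodesicOn γ' (Set.Icc a' b') →
    ConvexOn ℝ (Set.Icc a b ×ˢ Set.Icc a' b')
      (fun p : ℝ × ℝ => dist (γ p.1) (γ' p.2))

/-- Geodesic completeness: every geodesic segment extends to a geodesic line. -/
def GeodesicallyComplete (H : Type*) [MetricSpace H] : Prop :=
  ∀ (a b : ℝ) (γ : ℝ → H), a ≤ b → IsGeodesicOn γ (Set.Icc a b) →
    ∃ γ' : ℝ → H, IsGeodesicLine γ' ∧ ∀ t ∈ Set.Icc a b, γ' t = γ t

/-- The Busemann function with respect to the boundary point represented by the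
geodesic ray `aRep` and the base point `w`. -/
def busemann (w : H) (aRep : ℝ → H) (x : H) : ℝ :=
  sSup { b : ℝ | ∃ k : ℝ → H, IsRayFrom w k ∧ FinHausRays aRep k ∧
    b = Filter.limsup (fun t => dist x (k t) - t) Filter.atTop }

/-- The height function: minus the Busemann function. -/
def height (w : H) (aRep : ℝ → H) (x : H) : ℝ := - busemann w aRep x

/-- A vertical geodesic (forward oriented): a geodesic line whose height tends to `+∞`. -/
def IsVerticalGeodesic (w : H) (aRep : ℝ → H) (V : ℝ → H) : Prop :=
  IsGeodesicLine V ∧ Tendsto (fun t => height w aRep (V t)) atTop atTop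

/-- A vertical geodesic line (either orientation): a geodesic line whose image lies
in the boundary class, i.e. whose height tends to `+∞` along one of its ends. -/
def IsVerticalGeodesicLine (w : H) (aRep : ℝ → H) (V : ℝ → H) : Prop :=
  IsGeodesicLine V ∧
    (Tendsto (fun t => height w aRep (V t)) atTop atTop ∨
     Tendsto (fun t => height w aRep (V t)) atBot atTop)

/-- A vertical geodesic parametrised by its height: `h(V(t)) = t` for all `t`. -/
def VertParam (w : H) (aRep : ℝ → H) (V : ℝ → H) : Prop :=
  IsGeodesicLine V ∧ ∀ t : ℝ, height w aRep (V t) = t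

/-- Height difference `Δh(x,y)`. -/
def dh (w : H) (aRep : ℝ → H) (x y : H) : ℝ :=
  |height w aRep x - height w aRep y|

/-- Relative distance `d_r(x,y) = d(x,y) - Δh(x,y)`. -/
def dr (w : H) (aRep : ℝ → H) (x y : H) : ℝ := dist x y - dh w aRep x y

/-- Maximal height `h⁺` of a path along the parameter set `I`. -/
def hplusOn (w : H) (aRep : ℝ → H) (γ : ℝ → H) (I : Set ℝ) : ℝ :=
  sSup ((fun t => height w aRep (γ t)) '' I)

/-- Minimal height `h⁻` of a path along the parameter set `I`. -/
def hminusOn (w : H) (aRep : ℝ → H) (γ : ℝ → H) (I : Set ℝ) : ℝ :=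
  sInf ((fun t => height w aRep (γ t)) '' I)

/-- A path parametrised by arclength: the length of the piece on `[s,t]` equals `t - s`. -/
def ArclengthPath (V : ℝ → H) : Prop :=
  ∀ s t : ℝ, s ≤ t → eVariationOn V (Set.Icc s t) = ENNReal.ofReal (t - s)

/-- An admissible norm on `ℝ²`: a norm with `N(1,1) = 1` and `N(a,b) ≥ (a+b)/2`. -/
structure AdmNorm where
  toFun : ℝ × ℝ → ℝ
  eq_zero_iff : ∀ v : ℝ × ℝ, toFun v = 0 ↔ v = 0
  smul_eq : ∀ (c : ℝ) (v : ℝ × ℝ), toFun (c • v) = |c| * toFun v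
  add_le : ∀ v w : ℝ × ℝ, toFun (v + w) ≤ toFun v + toFun w
  one_one : toFun (1, 1) = 1
  adm : ∀ a b : ℝ, (a + b) / 2 ≤ toFun (a, b)

/-- `C` is a comparison constant `C_N` for the admissible norm `N`:
`C ≥ 1` and `N(a,b) ≤ C(a+b)/2` for all `a,b ≥ 0`. -/
def AdmNorm.BoundConst (N : AdmNorm) (C : ℝ) : Prop :=
  1 ≤ C ∧ ∀ a b : ℝ, 0 ≤ a → 0 ≤ b → N.toFun (a, b) ≤ C * (a + b) / 2

variable {Hp Hq : Type*} [MetricSpace Hp] [MetricSpace Hq]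

/-- Membership in the horospherical product: `h_p(x_p) + h_q(x_q) = 0`. -/
def inHoro (wp : Hp) (ap : ℝ → Hp) (wq : Hq) (aq : ℝ → Hq) (z : Hp × Hq) : Prop :=
  height wp ap z.1 + height wq aq z.2 = 0

/-- The `N`-length of a path in `Hp × Hq`: supremum over finite monotone
subdivisions of the sums of the `N(d_p, d_q)`-distances. -/
def lN (Nf : ℝ × ℝ → ℝ) (γ : ℝ → Hp × Hq) (s : Set ℝ) : ℝ≥0∞ :=
  ⨆ p : ℕ × { u : ℕ → ℝ // Monotone u ∧ ∀ i, u i ∈ s },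
    ∑ i ∈ Finset.range p.1,
      ENNReal.ofReal (Nf (dist (γ (p.2.1 (i+1))).1 (γ (p.2.1 i)).1,
                          dist (γ (p.2.1 (i+1))).2 (γ (p.2.1 i)).2))

/-- The `N`-path metric: infimum of `N`-lengths of connected paths staying in the
horospherical product and joining the two points. -/
def dHN (Nf : ℝ × ℝ → ℝ) (mem : Hp × Hq → Prop) (x y : Hp × Hq) : ℝ≥0∞ :=
  ⨅ (T : ℝ) (_ : 0 ≤ T) (γ : ℝ → Hp × Hq) (_ : ContinuousOn γ (Set.Icc 0 T))
    (_ : ∀ t ∈ Set.Icc (0:ℝ) T, mem (γ t)) (_ : γ 0 = x) (_ : γ T = y),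
    lN Nf γ (Set.Icc 0 T)

/-- A geodesic of the horospherical product with respect to the `N`-path metric,
parametrised (by arclength) on `I` and staying in the product. -/
def IsHNGeodesicOn (Nf : ℝ × ℝ → ℝ) (mem : Hp × Hq → Prop)
    (α : ℝ → Hp × Hq) (I : Set ℝ) : Prop :=
  (∀ t ∈ I, mem (α t)) ∧
  ∀ s ∈ I, ∀ t ∈ I, dHN Nf mem (α s) (α t) = ENNReal.ofReal |s - t|

/-- A vertical geodesic of the horospherical product, parametrised by its height. -/
def IsHNVerticalLine (Nf : ℝ × ℝ → ℝ) (mem : Hp × Hq → Prop)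
    (wp : Hp) (ap : ℝ → Hp) (V : ℝ → Hp × Hq) : Prop :=
  IsHNGeodesicOn Nf mem V Set.univ ∧ ∀ t : ℝ, height wp ap (V t).1 = t

/-- Maximal height `h⁺` of a path of the horospherical product. -/
def hplusH (wp : Hp) (ap : ℝ → Hp) (γ : ℝ → Hp × Hq) (I : Set ℝ) : ℝ :=
  sSup ((fun t => height wp ap (γ t).1) '' I)

/-- Minimal height `h⁻` of a path of the horospherical product. -/
def hminusH (wp : Hp) (ap : ℝ → Hp) (γ : ℝ → Hp × Hq) (I : Set ℝ) : ℝ :=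
  sInf ((fun t => height wp ap (γ t).1) '' I)

/-- `H_p`-type path at scale `κ`: the first component stays `κ`-close to a geodesic
of `H_p` and the second component stays `κ`-close to a vertical geodesic of `H_q`. -/
def IsHpType (wq : Hq) (aq : ℝ → Hq) (κ : ℝ) (α : ℝ → Hp × Hq) : Prop :=
  (∃ g : ℝ → Hp, IsGeodesicLine g ∧ ∀ t : ℝ, ∃ s : ℝ, dist (α t).1 (g s) ≤ κ) ∧
  (∃ v : ℝ → Hq, IsVerticalGeodesicLine wq aq v ∧ ∀ t : ℝ, ∃ s : ℝ, dist (α t).2 (v s) ≤ κ)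

/-- `H_q`-type path at scale `κ`. -/
def IsHqType (wp : Hp) (ap : ℝ → Hp) (κ : ℝ) (α : ℝ → Hp × Hq) : Prop :=
  (∃ g : ℝ → Hq, IsGeodesicLine g ∧ ∀ t : ℝ, ∃ s : ℝ, dist (α t).2 (g s) ≤ κ) ∧
  (∃ v : ℝ → Hp, IsVerticalGeodesicLine wp ap v ∧ ∀ t : ℝ, ∃ s : ℝ, dist (α t).1 (v s) ≤ κ)

/-- Finite Hausdorff distance on `[0,∞)` between two rays, for a generalized
(`ℝ≥0∞`-valued) distance `dd`. -/
def HNFinHaus {X : Type*} (dd : X → X → ℝ≥0∞) (α β : ℝ → X) : Prop :=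
  ∃ C : ℝ, (∀ s : ℝ, 0 ≤ s → ∃ t : ℝ, 0 ≤ t ∧ dd (α s) (β t) ≤ ENNReal.ofReal C) ∧
           (∀ t : ℝ, 0 ≤ t → ∃ s : ℝ, 0 ≤ s ∧ dd (α s) (β t) ≤ ENNReal.ofReal C)

theorem finHaus_equivalence (H : Type*) [MetricSpace H] :
    Equivalence (fun γ₁ γ₂ : {γ : ℝ → H // IsGeodesicRay γ} => FinHausRays γ₁.1 γ₂.1) := by
  constructor
  · intro γ
    exact ⟨0, fun s hs => ⟨s, hs, by simp⟩, fun t ht => ⟨t, ht, by simp⟩⟩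
  · rintro γ₁ γ₂ ⟨C, h1, h2⟩
    refine ⟨C, fun s hs => ?_, fun t ht => ?_⟩
    · obtain ⟨u, hu, hd⟩ := h2 s hs
      exact ⟨u, hu, by rwa [dist_comm]⟩
    · obtain ⟨u, hu, hd⟩ := h1 t ht
      exact ⟨u, hu, by rwa [dist_comm]⟩
  · rintro γ₁ γ₂ γ₃ ⟨C, h1, h2⟩ ⟨D, g1, g2⟩
    refine ⟨C + D, fun s hs => ?_, fun t ht => ?_⟩
    · obtain ⟨u, hu, hd⟩ := h1 s hs
      obtain ⟨v, hv, he⟩ := g1 u hu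
      exact ⟨v, hv, (dist_triangle _ (γ₂.1 u) _).trans (add_le_add hd he)⟩
    · obtain ⟨u, hu, hd⟩ := g2 t ht
      obtain ⟨v, hv, he⟩ := h2 u hu
      exact ⟨v, hv, (dist_triangle _ (γ₂.1 u) _).trans (add_le_add he hd)⟩

/-- The setoid of geodesic rays up to finite Hausdorff distance. -/
instance raySetoid (H : Type*) [MetricSpace H] : Setoid {γ : ℝ → H // IsGeodesicRay γ} :=
  ⟨fun γ₁ γ₂ => FinHausRays γ₁.1 γ₂.1, finHaus_equivalence H⟩

/-- The Gromov boundary: equivalence classes of geodesic rays at finite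
Hausdorff distance. -/
abbrev Bdry (H : Type*) [MetricSpace H] := Quotient (raySetoid H)

/-- The boundary point determined by a geodesic ray. -/
def bdryPt {H : Type*} [MetricSpace H] (γ : ℝ → H) (h : IsGeodesicRay γ) : Bdry H :=
  Quotient.mk (raySetoid H) ⟨γ, h⟩

/-- The set `((∂H_p ∖ {a_p}) × {a_q}) ∪ ({a_p} × (∂H_q ∖ {a_q}))`. -/
def bdryTarget {Hp Hq : Type*} [MetricSpace Hp] [MetricSpace Hq]
    (ap : ℝ → Hp) (hap : IsGeodesicRay ap)
    (aq : ℝ → Hq) (haq : IsGeodesicRay aq) : Set (Bdry Hp × Bdry Hq) :=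
  ((({bdryPt ap hap} : Set (Bdry Hp))ᶜ ×ˢ ({bdryPt aq haq} : Set (Bdry Hq))) ∪
   (({bdryPt ap hap} : Set (Bdry Hp)) ×ˢ ({bdryPt aq haq} : Set (Bdry Hq))ᶜ))

section Coarse

theorem exists_first_time {f : ℝ → ℝ} {a b l : ℝ} (hab : a ≤ b) (hf : ContinuousOn f (Icc a b))
    (h1 : f a ≤ l) (h2 : l ≤ f b) :
    ∃ t ∈ Icc a b, f t = l ∧ ∀ r ∈ Icc a t, f r ≤ l := by
  have hne : (Icc a b ∩ f ⁻¹' {l}).Nonempty := by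
    obtain ⟨t, ht, htl⟩ := intermediate_value_Icc hab hf ⟨h1, h2⟩
    exact ⟨t, ht, htl⟩
  have hcl : IsClosed (Icc a b ∩ f ⁻¹' {l}) :=
    hf.preimage_isClosed_of_isClosed isClosed_Icc isClosed_singleton
  obtain ⟨t, ⟨ht, htl⟩, hmin⟩ :=
    (isCompact_Icc.of_isClosed_subset hcl inter_subset_left).exists_isLeast hne
  refine ⟨t, ht, htl, fun r hr => ?_⟩
  by_contra! hlt
  obtain ⟨t', ht', htl'⟩ := intermediate_value_Icc hr.1
    (hf.mono (Icc_subset_Icc_right (hr.2.trans ht.2))) ⟨h1, hlt.le⟩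
  have h3 : t ≤ t' := hmin ⟨⟨ht'.1, ht'.2.trans (hr.2.trans ht.2)⟩, htl'⟩
  have h4 : r = t := le_antisymm hr.2 (h3.trans ht'.2)
  rw [h4, htl] at hlt
  exact lt_irrefl _ hlt

theorem exists_last_time {f : ℝ → ℝ} {a b l : ℝ} (hab : a ≤ b) (hf : ContinuousOn f (Icc a b))
    (h1 : f a ≤ l) (h2 : l ≤ f b) :
    ∃ t ∈ Icc a b, f t = l ∧ ∀ r ∈ Icc t b, l ≤ f r := by
  have hg : ContinuousOn (fun x => -f (-x)) (Icc (-b) (-a)) := by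
    refine (hf.comp continuousOn_neg fun x hx => ?_).neg
    exact ⟨by linarith [hx.2], by linarith [hx.1]⟩
  obtain ⟨t, ht, htl, H⟩ := exists_first_time (neg_le_neg hab) hg (l := -l)
    (by simpa using h2) (by simpa using h1)
  refine ⟨-t, ⟨by linarith [ht.2], by linarith [ht.1]⟩, by linarith, fun r hr => ?_⟩
  have := H (-r) ⟨by linarith [hr.2], by linarith [hr.1]⟩
  simpa using this

/-- The quantities attached to a geodesic `α : [0,L] → Hp ⋈ Hq` that enter the coarse argument:
the height `h`, the distances `p` and `q` between the two components at two times, and constants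
`np`, `nq` (at least `1`) governing the cost of horizontal displacements. -/
structure CoarseGeodesic (np nq C δ L : ℝ) (h : ℝ → ℝ) (p q : ℝ → ℝ → ℝ) : Prop where
  one_le_C : 1 ≤ C
  one_le_δ : 1 ≤ δ
  np_mem : np ∈ Icc 1 C
  nq_mem : nq ∈ Icc 1 C
  le_p : ∀ s ∈ Icc 0 L, ∀ t ∈ Icc 0 L, |h t - h s| ≤ p s t
  le_q : ∀ s ∈ Icc 0 L, ∀ t ∈ Icc 0 L, |h t - h s| ≤ q s t
  sum_le : ∀ s ∈ Icc 0 L, ∀ t ∈ Icc 0 L, p s t + q s t ≤ 2 * |t - s|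
  upper : ∀ s ∈ Icc 0 L, ∀ t ∈ Icc 0 L,
    |t - s| ≤ |h t - h s| + np * (p s t - |h t - h s|) + nq * (q s t - |h t - h s|) + 12 * δ * C
  lower_p : ∀ s ∈ Icc 0 L, ∀ t ∈ Icc 0 L, np = 1 ∨ np * p s t ≤ |t - s| + C * q s t
  lower_q : ∀ s ∈ Icc 0 L, ∀ t ∈ Icc 0 L, nq = 1 ∨ nq * q s t ≤ |t - s| + C * p s t
  tree_p : ∀ r ∈ Icc 0 L, ∀ s ∈ Icc 0 L, ∀ t ∈ Icc 0 L,
    h r + h t + p r t ≤ max (h r + h s + p r s) (h s + h t + p s t) + 6 * δ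
  tree_q : ∀ r ∈ Icc 0 L, ∀ s ∈ Icc 0 L, ∀ t ∈ Icc 0 L,
    -h r - h t + q r t ≤ max (-h r - h s + q r s) (-h s - h t + q s t) + 6 * δ

namespace CoarseGeodesic

variable {np nq C δ L : ℝ} {h : ℝ → ℝ} {p q : ℝ → ℝ → ℝ}

/-- Exchanging the two factors. -/
theorem swap (G : CoarseGeodesic np nq C δ L h p q) :
    CoarseGeodesic nq np C δ L (fun t => -h t) q p := by
  have e : ∀ s t, |(-h t) - (-h s)| = |h t - h s| := fun s t => by
    rw [← abs_neg]; congr 1; ring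
  refine ⟨G.one_le_C, G.one_le_δ, G.nq_mem, G.np_mem, ?_, ?_, ?_, ?_, G.lower_q, G.lower_p, ?_, ?_⟩
  · intro s hs t ht; rw [e]; exact G.le_q s hs t ht
  · intro s hs t ht; rw [e]; exact G.le_p s hs t ht
  · intro s hs t ht; linarith [G.sum_le s hs t ht]
  · intro s hs t ht; rw [e]; linarith [G.upper s hs t ht]
  · intro r hr s hs t ht; simpa [sub_eq_add_neg] using G.tree_q r hr s hs t ht
  · intro r hr s hs t ht; simpa using G.tree_p r hr s hs t ht

/-- Reversing time. -/
theorem reverse (G : CoarseGeodesic np nq C δ L h p q) :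
    CoarseGeodesic np nq C δ L (fun t => h (L - t)) (fun s t => p (L - t) (L - s))
      (fun s t => q (L - t) (L - s)) := by
  have m : ∀ t ∈ Icc 0 L, L - t ∈ Icc 0 L := fun t ht => ⟨by linarith [ht.2], by linarith [ht.1]⟩
  have e : ∀ s t, (L - s) - (L - t) = t - s := fun s t => by ring
  refine ⟨G.one_le_C, G.one_le_δ, G.np_mem, G.nq_mem, ?_, ?_, ?_, ?_, ?_, ?_, ?_, ?_⟩
  · intro s hs t ht; rw [abs_sub_comm]; exact G.le_p _ (m t ht) _ (m s hs)
  · intro s hs t ht; rw [abs_sub_comm]; exact G.le_q _ (m t ht) _ (m s hs)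
  · intro s hs t ht; simpa only [e] using G.sum_le _ (m t ht) _ (m s hs)
  · intro s hs t ht
    rw [abs_sub_comm (h (L - t))]
    simpa only [e] using G.upper _ (m t ht) _ (m s hs)
  · intro s hs t ht; simpa only [e] using G.lower_p _ (m t ht) _ (m s hs)
  · intro s hs t ht; simpa only [e] using G.lower_q _ (m t ht) _ (m s hs)
  · intro r hr s hs t ht
    have := G.tree_p _ (m t ht) _ (m s hs) _ (m r hr)
    rw [max_comm] at this
    convert this using 1
    · ring
    · congr 2 <;> ring
  · intro r hr s hs t ht
    have := G.tree_q _ (m t ht) _ (m s hs) _ (m r hr)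
    rw [max_comm] at this
    convert this using 1
    · ring
    · congr 2 <;> ring

theorem lip (G : CoarseGeodesic np nq C δ L h p q) {s t : ℝ} (hs : s ∈ Icc 0 L)
    (ht : t ∈ Icc 0 L) : |h t - h s| ≤ |t - s| := by
  linarith [G.le_p s hs t ht, G.le_q s hs t ht, G.sum_le s hs t ht]

theorem continuousOn (G : CoarseGeodesic np nq C δ L h p q) : ContinuousOn h (Icc 0 L) := by
  refine LipschitzOnWith.continuousOn (K := 1) (LipschitzOnWith.of_dist_le_mul fun s hs t ht => ?_)
  simpa [Real.dist_eq] using G.lip ht hs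

theorem p_le (G : CoarseGeodesic np nq C δ L h p q) {s t : ℝ} (hs : s ∈ Icc 0 L)
    (ht : t ∈ Icc 0 L) (hst : s ≤ t) : p s t ≤ 2 * (t - s) - |h t - h s| := by
  have := G.sum_le s hs t ht
  rw [abs_of_nonneg (sub_nonneg.2 hst)] at this
  linarith [G.le_q s hs t ht]

/-- The merging height of the first components at times `s` and `t` exceeds the maximal height on
`[s,t]` only by a small proportion of the time lost on `[s,t]`. -/
theorem merge_le_aux (G : CoarseGeodesic np nq C δ L h p q) {s t B ε : ℝ} (hs : 0 ≤ s) (hst : s ≤ t)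
    (ht : t ≤ L) (hB : ∀ r ∈ Icc s t, h r ≤ B) (hε : 0 ≤ ε) (i : ℕ) :
    ∀ r ∈ Icc s t, r - s - |h r - h s| ≤ i * ε →
      h s + h r + p s r ≤ 2 * B + 2 * ε + 6 * δ * i := by
  have hδ := G.one_le_δ
  have mem : ∀ r ∈ Icc s t, r ∈ Icc 0 L := fun r hr => ⟨hs.trans hr.1, hr.2.trans ht⟩
  have key : ∀ r ∈ Icc s t, ∀ r' ∈ Icc s t, r ≤ r' → r' - r - |h r' - h r| ≤ ε →
      h r + h r' + p r r' ≤ 2 * B + 2 * ε := by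
    intro r hr r' hr' hrr' hle
    have h1 := G.p_le (mem r hr) (mem r' hr') hrr'
    rcases abs_cases (h r' - h r) with ⟨h2, -⟩ | ⟨h2, -⟩ <;> linarith [hB r hr, hB r' hr']
  have hsm : s ∈ Icc s t := ⟨le_rfl, hst⟩
  induction i with
  | zero =>
    intro r hr hle
    have := key s hsm r hr hr.1 (by simp at hle; linarith)
    simpa using this
  | succ i ih =>
    intro r hr hle
    push_cast at hle ⊢
    by_cases hc : r - s - |h r - h s| ≤ i * ε
    · linarith [ih r hr hc]
    · push Not at hc
      have hcont : ContinuousOn (fun r => r - s - |h r - h s|) (Icc s r) := by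
        have : ContinuousOn h (Icc s r) :=
          G.continuousOn.mono fun x hx => mem x ⟨hx.1, hx.2.trans hr.2⟩
        fun_prop
      obtain ⟨r', hr', hr'e⟩ := intermediate_value_Icc hr.1 hcont
        (show (i * ε : ℝ) ∈ Icc _ _ from ⟨by simp; positivity, hc.le⟩)
      have hr't : r' ∈ Icc s t := ⟨hr'.1, hr'.2.trans hr.2⟩
      have h1 := ih r' hr't hr'e.le
      have h2 := key r' hr't r hr hr'.2 (by
        have := abs_sub_le (h r) (h r') (h s)
        simp only at hr'e
        linarith)
      have h3 := G.tree_p s (mem s hsm) r' (mem r' hr't) r (mem r hr)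
      have h4 : max (h s + h r' + p s r') (h r' + h r + p r' r) ≤ 2 * B + 2 * ε + 6 * δ * i :=
        max_le h1 (by nlinarith [show (0 : ℝ) ≤ i from Nat.cast_nonneg i])
      linarith

theorem merge_p_le (G : CoarseGeodesic np nq C δ L h p q) {s t B e : ℝ} (hs : 0 ≤ s) (hst : s ≤ t)
    (ht : t ≤ L) (hB : ∀ r ∈ Icc s t, h r ≤ B) (he : t - s - |h t - h s| ≤ 4 * C * e) :
    h s + h t + p s t ≤ 2 * B + e + 54 * δ * C := by
  have hC := G.one_le_C
  have hδ := G.one_le_δ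
  obtain ⟨K, hK, hK'⟩ : ∃ K : ℕ, 8 * C ≤ K ∧ (K : ℝ) ≤ 9 * C :=
    ⟨⌈8 * C⌉₊, Nat.le_ceil _, by linarith [Nat.ceil_lt_add_one (show 0 ≤ 8 * C by linarith)]⟩
  have hlip := G.lip (s := s) (t := t) ⟨hs, hst.trans ht⟩ ⟨hs.trans hst, ht⟩
  rw [abs_of_nonneg (sub_nonneg.2 hst)] at hlip
  have he0 : 0 ≤ e := by
    by_contra! hneg
    nlinarith
  have h1 := G.merge_le_aux hs hst ht hB (div_nonneg he0 zero_le_two) K t ⟨hst, le_rfl⟩ (by nlinarith)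
  nlinarith

theorem merge_q_le (G : CoarseGeodesic np nq C δ L h p q) {s t B e : ℝ} (hs : 0 ≤ s) (hst : s ≤ t)
    (ht : t ≤ L) (hB : ∀ r ∈ Icc s t, B ≤ h r) (he : t - s - |h t - h s| ≤ 4 * C * e) :
    -h s - h t + q s t ≤ -2 * B + e + 54 * δ * C := by
  have := G.swap.merge_p_le (B := -B) hs hst ht (fun r hr => neg_le_neg (hB r hr)) (e := e) (by
    rwa [show (-h t) - (-h s) = -(h t - h s) by ring, abs_neg])
  linarith

/-- On an interval on which `h` stays within `D` of the range spanned by its end values, the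
geodesic is coarsely vertical. -/
theorem nearly_vertical (G : CoarseGeodesic np nq C δ L h p q) {s t D : ℝ} (hs : 0 ≤ s)
    (hst : s ≤ t) (ht : t ≤ L) (hmax : ∀ r ∈ Icc s t, h r ≤ max (h s) (h t) + D)
    (hmin : ∀ r ∈ Icc s t, min (h s) (h t) - D ≤ h r) :
    p s t ≤ |h t - h s| + 4 * D + 114 * δ * C ∧ q s t ≤ |h t - h s| + 4 * D + 114 * δ * C ∧
      t - s ≤ |h t - h s| + 8 * C * D + 240 * δ * C ^ 2 := by
  have hC := G.one_le_C
  have hδ := G.one_le_δ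
  have hsm : s ∈ Icc 0 L := ⟨hs, hst.trans ht⟩
  have htm : t ∈ Icc 0 L := ⟨hs.trans hst, ht⟩
  obtain ⟨e, he⟩ : ∃ e, t - s - |h t - h s| = 4 * C * e :=
    ⟨(t - s - |h t - h s|) / (4 * C), by field_simp⟩
  have h1 := G.merge_p_le hs hst ht hmax he.le
  have h2 := G.merge_q_le hs hst ht hmin he.le
  have h3 := G.upper s hsm t htm
  rw [abs_of_nonneg (sub_nonneg.2 hst)] at h3
  have hP : p s t - |h t - h s| ≤ 2 * D + e + 54 * δ * C := by
    rcases le_total (h s) (h t) with hle | hle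
    · rw [max_eq_right hle] at h1; rw [abs_of_nonneg (sub_nonneg.2 hle)]; linarith
    · rw [max_eq_left hle] at h1; rw [abs_of_nonpos (sub_nonpos.2 hle)]; linarith
  have hQ : q s t - |h t - h s| ≤ 2 * D + e + 54 * δ * C := by
    rcases le_total (h s) (h t) with hle | hle
    · rw [min_eq_left hle] at h2; rw [abs_of_nonneg (sub_nonneg.2 hle)]; linarith
    · rw [min_eq_right hle] at h2; rw [abs_of_nonpos (sub_nonpos.2 hle)]; linarith
  have hP0 := sub_nonneg.2 (G.le_p s hsm t htm)
  have hQ0 := sub_nonneg.2 (G.le_q s hsm t htm)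
  have h4 : np * (p s t - |h t - h s|) ≤ C * (2 * D + e + 54 * δ * C) :=
    mul_le_mul G.np_mem.2 hP hP0 (by linarith)
  have h5 : nq * (q s t - |h t - h s|) ≤ C * (2 * D + e + 54 * δ * C) :=
    mul_le_mul G.nq_mem.2 hQ hQ0 (by linarith)
  have h6 : C * e ≤ C * (2 * D + 60 * (δ * C)) := by
    have : δ * C ≤ δ * C * C := le_mul_of_one_le_right (by positivity) hC
    nlinarith
  have h7 : e ≤ 2 * D + 60 * (δ * C) := le_of_mul_le_mul_left h6 (by linarith)
  refine ⟨by linarith, by linarith, ?_⟩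
  nlinarith

/-- The time lost on an interval bounds the time lost on each subinterval. -/
theorem loss_mono (G : CoarseGeodesic np nq C δ L h p q) {s r r' t : ℝ} (hs : 0 ≤ s)
    (hsr : s ≤ r) (hrr' : r ≤ r') (hr't : r' ≤ t) (ht : t ≤ L) :
    r' - r - |h r' - h r| ≤ t - s - |h t - h s| := by
  have h1 := G.lip (s := s) (t := r) ⟨hs, by linarith⟩ ⟨by linarith, by linarith⟩
  have h2 := G.lip (s := r') (t := t) ⟨by linarith, by linarith⟩ ⟨by linarith, ht⟩
  rw [abs_of_nonneg (sub_nonneg.2 hsr)] at h1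
  rw [abs_of_nonneg (sub_nonneg.2 hr't)] at h2
  have h3 := abs_sub_le (h t) (h r') (h s)
  have h4 := abs_sub_le (h r') (h r) (h s)
  linarith

/-- `nearly_vertical` for a piece whose end values are extremal. -/
theorem loss_le (G : CoarseGeodesic np nq C δ L h p q) {s t : ℝ} (hs : 0 ≤ s)
    (hst : s ≤ t) (ht : t ≤ L) (H : ∀ r ∈ Icc s t, h r ∈ uIcc (h s) (h t)) :
    t - s - |h t - h s| ≤ 4 * C * (60 * δ * C) := by
  have := (G.nearly_vertical hs hst ht (D := 0) (fun r hr => by simpa using (H r hr).2)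
    (fun r hr => by simpa using (H r hr).1)).2.2
  linarith

/-- The cost of a turn at `b` between the coarsely vertical pieces of a path `a, b, c, d`. -/
theorem turn_cost (G : CoarseGeodesic np nq C δ L h p q) {a b c d : ℝ} (ha : 0 ≤ a) (hab : a ≤ b)
    (hbc : b ≤ c) (hcd : c ≤ d) (hd : d ≤ L)
    (h1 : ∀ r ∈ Icc a b, h r ∈ Icc (h b) (h a)) (h2 : ∀ r ∈ Icc b c, h r ∈ Icc (h b) (h c))
    (h3 : ∀ r ∈ Icc c d, h r ∈ Icc (h d) (h c))
    (hac : h a ≤ h c) (hbd : h b ≤ h d) (hda : h d + 240 * δ * C ^ 2 ≤ h a) :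
    nq * (q a d - |h d - h a|) ≤ 2 * (h d - h b) + 606 * δ * C ^ 2 := by
  have hC := G.one_le_C
  have hδ := G.one_le_δ
  have hδC : δ ≤ δ * C := le_mul_of_one_le_right (by linarith) hC
  have hδC2 : δ * C ≤ δ * C ^ 2 := by nlinarith
  have hba : h b ≤ h a := (h1 b ⟨hab, le_rfl⟩).2
  have hdc : h d ≤ h c := (h3 d ⟨hcd, le_rfl⟩).2
  have hδ0 : 0 ≤ δ * C ^ 2 := by positivity
  have e1 := G.loss_le ha hab (by linarith) fun r hr => by
    rw [uIcc_of_ge hba]; exact h1 r hr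
  have e2 := G.loss_le (ha.trans hab) hbc (hcd.trans hd) fun r hr => by
    rw [uIcc_of_le (hba.trans hac)]; exact h2 r hr
  have e3 := G.loss_le (by linarith) hcd hd fun r hr => by
    rw [uIcc_of_ge hdc]; exact h3 r hr
  have ma : a ∈ Icc 0 L := ⟨ha, by linarith⟩
  have mb : b ∈ Icc 0 L := ⟨by linarith, by linarith⟩
  have mc : c ∈ Icc 0 L := ⟨by linarith, by linarith⟩
  have md : d ∈ Icc 0 L := ⟨by linarith, hd⟩
  obtain ⟨m, hm, hma, hm'⟩ := exists_first_time hbc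
    (G.continuousOn.mono (Icc_subset_Icc mb.1 mc.2)) hba hac
  have mm : m ∈ Icc 0 L := ⟨mb.1.trans hm.1, hm.2.trans mc.2⟩
  have ebm := (G.loss_mono mb.1 le_rfl hm.1 hm.2 mc.2).trans e2
  have emc := (G.loss_mono mb.1 hm.1 hm.2 le_rfl mc.2).trans e2
  -- the first components at times `a` and `m` are close
  have p1 := G.merge_p_le ha hab mb.2 (fun r hr => (h1 r hr).2) e1
  have p2 := G.merge_p_le mb.1 hm.1 mm.2 hm' ebm
  have hpam : p a m ≤ 120 * δ * C := by
    have h4 := G.tree_p a ma b mb m mm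
    have h5 : max (h a + h b + p a b) (h b + h m + p b m) ≤ 2 * h a + 114 * δ * C :=
      max_le (by linarith) (by linarith)
    linarith
  -- the second components at times `m` and `d` are merged at height about `h d`
  have hdip : ∀ r ∈ Icc m c, h d ≤ h r := by
    intro r hr
    have mr : r ∈ Icc 0 L := ⟨mm.1.trans hr.1, hr.2.trans mc.2⟩
    have h4 := G.lip mm mr
    have h5 := G.lip mr mc
    rw [abs_of_nonneg (sub_nonneg.2 hr.1)] at h4
    rw [abs_of_nonneg (sub_nonneg.2 hr.2)] at h5
    have h6 := abs_of_nonneg (show 0 ≤ h c - h m by linarith)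
    have h7 := neg_le_abs (h r - h m)
    have h8 := le_abs_self (h c - h r)
    linarith
  have q1 := G.merge_q_le mm.1 hm.2 mc.2 hdip emc
  have q2 := G.merge_q_le mc.1 hcd hd (fun r hr => (h3 r hr).1) e3
  have hqmd : -h m - h d + q m d ≤ -2 * h d + 120 * δ * C := by
    have h4 := G.tree_q m mm c mc d md
    have h5 : max (-h m - h c + q m c) (-h c - h d + q c d) ≤ -2 * h d + 114 * δ * C :=
      max_le (by linarith) (by linarith)
    linarith
  have hv : -h a - h d + q a d ≤ -2 * h b + 126 * δ * C := by
    have q3 := G.merge_q_le ha hab mb.2 (fun r hr => (h1 r hr).1) e1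
    have q4 := G.merge_q_le mb.1 hbc mc.2 (fun r hr => (h2 r hr).1) e2
    have h4 := G.tree_q a ma b mb c mc
    have h5 : max (-h a - h b + q a b) (-h b - h c + q b c) ≤ -2 * h b + 114 * δ * C :=
      max_le (by linarith) (by linarith)
    have h6 := G.tree_q a ma c mc d md
    have h7 : max (-h a - h c + q a c) (-h c - h d + q c d) ≤ -2 * h b + 120 * δ * C :=
      max_le (by linarith) (by linarith)
    linarith
  have hv0 := sub_nonneg.2 (G.le_q a ma d md)
  have had : |h d - h a| = h a - h d := by
    rw [abs_of_nonpos (by linarith)]; ring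
  rw [had] at hv0 ⊢
  have hsmall : q a d - (h a - h d) ≤ 126 * δ * C →
      nq * (q a d - (h a - h d)) ≤ 2 * (h d - h b) + 606 * δ * C ^ 2 := by
    intro h4
    have := mul_le_mul G.nq_mem.2 h4 hv0 (by linarith)
    linarith
  have h4 := G.tree_q a ma m mm d md
  rcases le_total (-h a - h m + q a m) (-h m - h d + q m d) with h5 | h5
  · rw [max_eq_right h5] at h4
    exact hsmall (by linarith)
  rw [max_eq_left h5] at h4
  rcases G.lower_q a ma m mm with h6 | h6
  · rw [h6]; linarith
  rw [abs_of_nonneg (show 0 ≤ m - a by linarith [hm.1])] at h6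
  have h7 : C * p a m ≤ C * (120 * δ * C) := mul_le_mul_of_nonneg_left hpam (by linarith)
  rw [abs_of_nonpos (by linarith)] at e1
  rw [abs_of_nonneg (by linarith)] at ebm
  have h8 : (nq - 1) * (q a d - (h a - h d)) ≤ (nq - 1) * q a m :=
    mul_le_mul_of_nonneg_left (by linarith) (by linarith [G.nq_mem.1])
  linarith

theorem turn_cost_p (G : CoarseGeodesic np nq C δ L h p q) {a b c d : ℝ} (ha : 0 ≤ a)
    (hab : a ≤ b) (hbc : b ≤ c) (hcd : c ≤ d) (hd : d ≤ L)
    (h1 : ∀ r ∈ Icc a b, h r ∈ Icc (h b) (h a)) (h2 : ∀ r ∈ Icc b c, h r ∈ Icc (h b) (h c))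
    (h3 : ∀ r ∈ Icc c d, h r ∈ Icc (h d) (h c))
    (hac : h a ≤ h c) (hbd : h b ≤ h d) (hda : h d + 240 * δ * C ^ 2 ≤ h a) :
    np * (p a d - |h d - h a|) ≤ 2 * (h c - h a) + 606 * δ * C ^ 2 := by
  have key : ∀ x y : ℝ, ∀ s t u v, L - y = s → L - x = t →
      (∀ r ∈ Icc x y, h r ∈ Icc u v) → ∀ r ∈ Icc s t, -h (L - r) ∈ Icc (-v) (-u) := by
    rintro x y s t u v rfl rfl H r hr
    have := H (L - r) ⟨by linarith [hr.2], by linarith [hr.1]⟩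
    exact ⟨neg_le_neg this.2, neg_le_neg this.1⟩
  have := G.reverse.swap.turn_cost (a := L - d) (b := L - c) (c := L - b) (d := L - a)
    (by linarith) (by linarith) (by linarith) (by linarith) (by linarith)
    (key c d _ _ _ _ rfl rfl (by simpa using h3)) (key b c _ _ _ _ rfl rfl (by simpa using h2))
    (key a b _ _ _ _ rfl rfl (by simpa using h1))
    (by simpa using hbd) (by simpa using hac) (by simp only [sub_sub_cancel]; linarith)
  simp only [sub_sub_cancel] at this
  rw [show -h a - -h d = h d - h a by ring] at this
  linarith

/-- A geodesic does not descend in three monotone pieces `a, b, c, d` turning twice. -/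
theorem zigzag_down (G : CoarseGeodesic np nq C δ L h p q) {a b c d : ℝ} (ha : 0 ≤ a)
    (hab : a ≤ b) (hbc : b ≤ c) (hcd : c ≤ d) (hd : d ≤ L)
    (h1 : ∀ r ∈ Icc a b, h r ∈ Icc (h b) (h a)) (h2 : ∀ r ∈ Icc b c, h r ∈ Icc (h b) (h c))
    (h3 : ∀ r ∈ Icc c d, h r ∈ Icc (h d) (h c)) (hac : h a ≤ h c) (hbd : h b ≤ h d) :
    h a - h d ≤ 612 * δ * C ^ 2 := by
  have hC := G.one_le_C
  have hδ := G.one_le_δ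
  have hδC2 : δ * C ≤ δ * C ^ 2 := by
    have : δ * C ≤ δ * C * C := le_mul_of_one_le_right (by positivity) hC
    linarith
  have hδ0 : 0 ≤ δ * C ^ 2 := by positivity
  by_contra! hlt
  have hda : h d + 240 * δ * C ^ 2 ≤ h a := by linarith
  have t1 := G.turn_cost ha hab hbc hcd hd h1 h2 h3 hac hbd hda
  have t2 := G.turn_cost_p ha hab hbc hcd hd h1 h2 h3 hac hbd hda
  have ma : a ∈ Icc 0 L := ⟨ha, by linarith⟩
  have mb : b ∈ Icc 0 L := ⟨by linarith, by linarith⟩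
  have mc : c ∈ Icc 0 L := ⟨by linarith, by linarith⟩
  have md : d ∈ Icc 0 L := ⟨by linarith, hd⟩
  have l1 := (neg_le_abs _).trans (G.lip ma mb)
  have l2 := (le_abs_self _).trans (G.lip mb mc)
  have l3 := (neg_le_abs _).trans (G.lip mc md)
  have u := G.upper a ma d md
  rw [abs_of_nonneg (sub_nonneg.2 hab)] at l1
  rw [abs_of_nonneg (sub_nonneg.2 hbc)] at l2
  rw [abs_of_nonneg (sub_nonneg.2 hcd)] at l3
  rw [abs_of_nonneg (show 0 ≤ d - a by linarith), abs_of_nonpos (by linarith)] at u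
  rw [abs_of_nonpos (by linarith)] at t1 t2
  linarith

theorem zigzag_up (G : CoarseGeodesic np nq C δ L h p q) {a b c d : ℝ} (ha : 0 ≤ a)
    (hab : a ≤ b) (hbc : b ≤ c) (hcd : c ≤ d) (hd : d ≤ L)
    (h1 : ∀ r ∈ Icc a b, h r ∈ Icc (h a) (h b)) (h2 : ∀ r ∈ Icc b c, h r ∈ Icc (h c) (h b))
    (h3 : ∀ r ∈ Icc c d, h r ∈ Icc (h c) (h d)) (hac : h c ≤ h a) (hbd : h d ≤ h b) :
    h d - h a ≤ 612 * δ * C ^ 2 := by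
  have := G.swap.zigzag_down ha hab hbc hcd hd
    (fun r hr => ⟨neg_le_neg (h1 r hr).2, neg_le_neg (h1 r hr).1⟩)
    (fun r hr => ⟨neg_le_neg (h2 r hr).2, neg_le_neg (h2 r hr).1⟩)
    (fun r hr => ⟨neg_le_neg (h3 r hr).2, neg_le_neg (h3 r hr).1⟩)
    (neg_le_neg hac) (neg_le_neg hbd)
  linarith

theorem rise_le_of_le_min (G : CoarseGeodesic np nq C δ L h p q) {tm tM r r' : ℝ}
    (htM : tM ≤ L) (hm : tm ≤ tM) (hmin : ∀ r ∈ Icc 0 L, h tm ≤ h r)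
    (hmax : ∀ r ∈ Icc 0 L, h r ≤ h tM) (hr : 0 ≤ r) (hrr' : r ≤ r') (hr' : r' ≤ tm) :
    h r' - h r ≤ 612 * δ * C ^ 2 := by
  have mono : ∀ {x y : ℝ}, 0 ≤ x → y ≤ L → Icc x y ⊆ Icc 0 L := fun hx hy => Icc_subset_Icc hx hy
  have htm : tm ≤ L := hm.trans htM
  obtain ⟨b, hb, hbmax⟩ := isCompact_Icc.exists_isMaxOn ⟨r, le_rfl, hrr'.trans hr'⟩
    (G.continuousOn.mono (mono hr htm))
  replace hbmax : ∀ x ∈ Icc r tm, h x ≤ h b := fun x hx => hbmax hx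
  have hb0 : 0 ≤ b := hr.trans hb.1
  obtain ⟨a, ha, hae, ha'⟩ := exists_last_time hb.1
    (G.continuousOn.mono (mono hr (hb.2.trans htm))) le_rfl (hbmax r ⟨le_rfl, hrr'.trans hr'⟩)
  obtain ⟨d, hd, hde, hd'⟩ := exists_first_time hm
    (G.continuousOn.mono (mono (hb0.trans hb.2) htM)) (hmin b ⟨hb0, hb.2.trans htm⟩)
    (hmax b ⟨hb0, hb.2.trans htm⟩)
  have := G.zigzag_up (hr.trans ha.1) ha.2 hb.2 hd.1 (hd.2.trans htM)
    (fun x hx => ⟨hae ▸ ha' x hx, hbmax x ⟨ha.1.trans hx.1, hx.2.trans hb.2⟩⟩)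
    (fun x hx => ⟨hmin x ⟨hb0.trans hx.1, hx.2.trans htm⟩, hbmax x ⟨hb.1.trans hx.1, hx.2⟩⟩)
    (fun x hx => ⟨hmin x ⟨by linarith [hx.1, hb.2], by linarith [hx.2, hd.2]⟩,
      hde ▸ hd' x hx⟩)
    (hmin a ⟨hr.trans ha.1, by linarith [ha.2, hb.2]⟩) hde.le
  linarith [hbmax r' ⟨hrr', hr'⟩]

theorem start_sub_end_le (G : CoarseGeodesic np nq C δ L h p q) {tm tM : ℝ} (htm : 0 ≤ tm)
    (htM : tM ≤ L) (hm : tm ≤ tM) (hmin : ∀ r ∈ Icc 0 L, h tm ≤ h r)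
    (hmax : ∀ r ∈ Icc 0 L, h r ≤ h tM) : h 0 - h L ≤ 612 * δ * C ^ 2 := by
  have m0 : (0 : ℝ) ∈ Icc 0 L := ⟨le_rfl, by linarith⟩
  have mL : L ∈ Icc 0 L := ⟨by linarith, le_rfl⟩
  obtain ⟨a, ha, hae, ha'⟩ := exists_last_time htm
    (G.swap.continuousOn.mono (Icc_subset_Icc le_rfl (hm.trans htM))) le_rfl
    (neg_le_neg (hmin 0 m0))
  obtain ⟨d, hd, hde, hd'⟩ := exists_first_time htM
    (G.swap.continuousOn.mono (Icc_subset_Icc (htm.trans hm) le_rfl))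
    (neg_le_neg (hmax L mL)) le_rfl
  simp only [neg_inj, neg_le_neg_iff] at hae ha' hde hd'
  have := G.zigzag_down ha.1 ha.2 hm hd.1 hd.2
    (fun x hx => ⟨hmin x ⟨ha.1.trans hx.1, by linarith [hx.2]⟩, hae ▸ ha' x hx⟩)
    (fun x hx => ⟨hmin x ⟨htm.trans hx.1, hx.2.trans htM⟩,
      hmax x ⟨htm.trans hx.1, hx.2.trans htM⟩⟩)
    (fun x hx => ⟨hde ▸ hd' x hx, hmax x ⟨by linarith [hx.1], hx.2.trans hd.2⟩⟩)
    (hmax a ⟨ha.1, by linarith [ha.2]⟩) (hmin d ⟨by linarith [hd.1], hd.2⟩)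
  linarith

theorem before_min (G : CoarseGeodesic np nq C δ L h p q) {tm tM r : ℝ}
    (htM : tM ≤ L) (hm : tm ≤ tM) (hmin : ∀ r ∈ Icc 0 L, h tm ≤ h r)
    (hmax : ∀ r ∈ Icc 0 L, h r ≤ h tM) (hr : r ∈ Icc 0 tm) :
    p r tm - (h r - h tm) ≤ 3800 * δ * C ^ 2 ∧ q 0 r - (h 0 - h r) ≤ 3800 * δ * C ^ 2 := by
  have hC := G.one_le_C
  have hδ := G.one_le_δ
  have hδC2 : δ * C ≤ δ * C ^ 2 := by
    have : δ * C ≤ δ * C * C := le_mul_of_one_le_right (by positivity) hC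
    linarith
  have hδ0 : 0 ≤ δ * C ^ 2 := by positivity
  have htm : tm ≤ L := hm.trans htM
  have rise := fun {x y : ℝ} => G.rise_le_of_le_min (r := x) (r' := y) htM hm hmin hmax
  have hmr := hmin r ⟨hr.1, hr.2.trans htm⟩
  constructor
  · have := (G.nearly_vertical (D := 612 * δ * C ^ 2) hr.1 hr.2 htm
      (fun x hx => by linarith [rise hr.1 hx.1 hx.2, le_max_left (h r) (h tm)])
      (fun x hx => by
        linarith [hmin x ⟨hr.1.trans hx.1, hx.2.trans htm⟩, min_le_right (h r) (h tm)])).1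
    rw [abs_of_nonpos (by linarith)] at this
    linarith
  · have := (G.nearly_vertical (D := 612 * δ * C ^ 2) le_rfl hr.1 (hr.2.trans htm)
      (fun x hx => by linarith [rise le_rfl hx.1 (hx.2.trans hr.2), le_max_left (h 0) (h r)])
      (fun x hx => by linarith [rise hx.1 hx.2 hr.2, min_le_right (h 0) (h r)])).2.1
    have h1 := rise le_rfl hr.1 hr.2
    rcases abs_cases (h r - h 0) with ⟨h2, -⟩ | ⟨h2, -⟩ <;> linarith

theorem between (G : CoarseGeodesic np nq C δ L h p q) {tm tM r : ℝ} (htm : 0 ≤ tm)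
    (htM : tM ≤ L) (hmin : ∀ r ∈ Icc 0 L, h tm ≤ h r)
    (hmax : ∀ r ∈ Icc 0 L, h r ≤ h tM) (hr : r ∈ Icc tm tM) :
    p tm r - (h r - h tm) ≤ 3800 * δ * C ^ 2 ∧ q r tM - (h tM - h r) ≤ 3800 * δ * C ^ 2 := by
  have hC := G.one_le_C
  have hδ := G.one_le_δ
  have hδ0 : 0 ≤ δ * C ^ 2 := by positivity
  have mm : tm ∈ Icc 0 L := ⟨htm, by linarith [hr.1, hr.2]⟩
  have mM : tM ∈ Icc 0 L := ⟨by linarith [hr.1, hr.2], htM⟩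
  have mr : r ∈ Icc 0 L := ⟨htm.trans hr.1, hr.2.trans htM⟩
  have e := G.loss_le htm (hr.1.trans hr.2) htM fun x hx => by
    rw [uIcc_of_le (hmin tM mM)]
    exact ⟨hmin x ⟨htm.trans hx.1, hx.2.trans htM⟩, hmax x ⟨htm.trans hx.1, hx.2.trans htM⟩⟩
  have e1 := G.loss_mono htm le_rfl hr.1 hr.2 htM
  have e2 := G.loss_mono htm hr.1 hr.2 le_rfl htM
  have s1 := G.sum_le tm mm r mr
  have s2 := G.sum_le r mr tM mM
  have l1 := G.le_q tm mm r mr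
  have l2 := G.le_p r mr tM mM
  rw [abs_of_nonneg (sub_nonneg.2 hr.1)] at s1
  rw [abs_of_nonneg (sub_nonneg.2 hr.2)] at s2
  rw [abs_of_nonneg (sub_nonneg.2 (hmin r mr))] at e1 l1
  rw [abs_of_nonneg (sub_nonneg.2 (hmax r mr))] at e2 l2
  constructor <;> linarith

theorem after_max (G : CoarseGeodesic np nq C δ L h p q) {tm tM r : ℝ} (htm : 0 ≤ tm)
    (hm : tm ≤ tM) (hmin : ∀ r ∈ Icc 0 L, h tm ≤ h r)
    (hmax : ∀ r ∈ Icc 0 L, h r ≤ h tM) (hr : r ∈ Icc tM L) :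
    p r L - (h r - h L) ≤ 3800 * δ * C ^ 2 ∧ q tM r - (h tM - h r) ≤ 3800 * δ * C ^ 2 := by
  have m : ∀ t ∈ Icc 0 L, L - t ∈ Icc 0 L := fun t ht => ⟨by linarith [ht.2], by linarith [ht.1]⟩
  have := G.reverse.swap.before_min (tm := L - tM) (tM := L - tm) (r := L - r)
    (by linarith) (by linarith)
    (fun t ht => by simpa using hmax _ (m t ht)) (fun t ht => by simpa using hmin _ (m t ht))
    ⟨by linarith [hr.2], by linarith [hr.1]⟩
  simp only [sub_sub_cancel, sub_zero] at this
  constructor <;> linarith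

end CoarseGeodesic
end Coarse

section Factor

variable {w : H} {a : ℝ → H}

theorem IsRayFrom.dist_zero (ha : IsRayFrom w a) {s : ℝ} (hs : 0 ≤ s) : dist w (a s) = s := by
  rw [← ha.2, ha.1 0 self_mem_Ici s hs, zero_sub, abs_neg, abs_of_nonneg hs]

/-- In a Busemann space two asymptotic rays with the same origin coincide. -/
theorem ray_eq_of_finHaus (hB : BusemannSpace H) {k : ℝ → H} (ha : IsRayFrom w a)
    (hk : IsRayFrom w k) (hak : FinHausRays a k) {s : ℝ} (hs : 0 ≤ s) : k s = a s := by
  obtain ⟨C, hC, -⟩ := hak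
  have hbd : ∀ t, 0 ≤ t → dist (a t) (k t) ≤ 2 * C := by
    intro t ht
    obtain ⟨u, hu, hd⟩ := hC t ht
    have h1 := hk.1 u hu t ht
    have h2 : |u - t| ≤ dist (a t) (k u) := by
      rw [abs_le]
      have e1 := dist_triangle w (a t) (k u)
      have e2 := dist_triangle_right w (a t) (k u)
      rw [ha.dist_zero ht, hk.dist_zero hu] at e1 e2
      constructor <;> linarith
    linarith [dist_triangle (a t) (k u) (k t)]
  by_contra hne
  have hpos : 0 < dist (a s) (k s) := dist_pos.2 (Ne.symm hne)
  have hC0 : 0 ≤ C := by linarith [hbd s hs]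
  set T := s + (s * (2 * C) + 1) / dist (a s) (k s) with hT
  have hsT : s ≤ T := by
    rw [hT]; linarith [show 0 ≤ (s * (2 * C) + 1) / dist (a s) (k s) by positivity]
  have hT0 : 0 < T := by rw [hT]; positivity
  have hconv := (hB.2 0 T 0 T a k (fun x hx y hy => ha.1 x hx.1 y hy.1)
    (fun x hx y hy => hk.1 x hx.1 y hy.1)).2
    (show ((0 : ℝ), (0 : ℝ)) ∈ _ from ⟨⟨le_rfl, hT0.le⟩, ⟨le_rfl, hT0.le⟩⟩)
    (show (T, T) ∈ _ from ⟨⟨hT0.le, le_rfl⟩, ⟨hT0.le, le_rfl⟩⟩)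
    (show 0 ≤ 1 - s / T by rw [sub_nonneg, div_le_one hT0]; exact hsT)
    (show 0 ≤ s / T by positivity) (by ring)
  have e : s / T * T = s := div_mul_cancel₀ s hT0.ne'
  simp only [Prod.smul_mk, Prod.mk_add_mk, smul_eq_mul, mul_zero, zero_add, e, ha.2, hk.2,
    dist_self] at hconv
  have h1 : dist (a s) (k s) * T ≤ s * (2 * C) := by
    have h2 : s / T * dist (a T) (k T) ≤ s / T * (2 * C) :=
      mul_le_mul_of_nonneg_left (hbd T hT0.le) (by positivity)
    calc dist (a s) (k s) * T ≤ (s / T * (2 * C)) * T :=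
          mul_le_mul_of_nonneg_right (hconv.trans h2) hT0.le
      _ = s * (2 * C) := by field_simp
  have h2 : dist (a s) (k s) * T = dist (a s) (k s) * s + (s * (2 * C) + 1) := by
    rw [hT]; field_simp
  nlinarith

theorem tendsto_height (hB : BusemannSpace H) (ha : IsRayFrom w a) (x : H) :
    Tendsto (fun t => t - dist x (a t)) atTop (nhds (height w a x)) := by
  have hanti : Antitone fun t => dist x (a (max t 0)) - max t 0 := by
    intro s t hst
    have h1 := ha.1 (max s 0) (mem_Ici.2 (le_max_right _ _)) (max t 0) (mem_Ici.2 (le_max_right _ _))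
    rw [abs_sub_comm, abs_of_nonneg (sub_nonneg.2 (max_le_max_right 0 hst))] at h1
    have := dist_triangle x (a (max s 0)) (a (max t 0))
    simp only
    linarith
  have hbdd : BddBelow (range fun t => dist x (a (max t 0)) - max t 0) := by
    refine ⟨-dist x w, ?_⟩
    rintro _ ⟨t, rfl⟩
    have h1 := dist_triangle_left w (a (max t 0)) x
    rw [ha.dist_zero (le_max_right t 0)] at h1
    simp only
    linarith
  obtain ⟨l, hl⟩ : ∃ l, Tendsto (fun t => dist x (a t) - t) atTop (nhds l) := by
    refine ⟨_, (tendsto_atTop_ciInf hanti hbdd).congr' ?_⟩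
    filter_upwards [eventually_ge_atTop 0] with t ht
    rw [max_eq_left ht]
  have hset : { b : ℝ | ∃ k : ℝ → H, IsRayFrom w k ∧ FinHausRays a k ∧
      b = Filter.limsup (fun t => dist x (k t) - t) Filter.atTop } = {l} := by
    ext b
    constructor
    · rintro ⟨k, hk, hak, rfl⟩
      refine Tendsto.limsup_eq (hl.congr' ?_)
      filter_upwards [eventually_ge_atTop 0] with t ht
      rw [ray_eq_of_finHaus hB ha hk hak ht]
    · rintro rfl
      exact ⟨a, ha, ⟨0, fun s hs => ⟨s, hs, by simp⟩, fun t ht => ⟨t, ht, by simp⟩⟩,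
        hl.limsup_eq.symm⟩
  have : height w a x = -l := by rw [height, busemann, hset, csSup_singleton]
  rw [this]
  simpa using hl.neg

theorem height_sub_le (hB : BusemannSpace H) (ha : IsRayFrom w a) (x y : H) :
    |height w a x - height w a y| ≤ dist x y := by
  refine le_of_tendsto ((tendsto_height hB ha x).sub (tendsto_height hB ha y)).abs
    (Eventually.of_forall fun t => ?_)
  rw [sub_sub_sub_cancel_left, abs_sub_comm]
  exact abs_dist_sub_le x y (a t)

/-- Superlevel sets of the height are convex along geodesics. -/
theorem le_height_of_isGeodesicOn (hB : BusemannSpace H) (ha : IsRayFrom w a) {γ : ℝ → H}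
    {s t r l : ℝ} (hγ : IsGeodesicOn γ (Icc s t)) (hr : r ∈ Icc s t)
    (hs : l ≤ height w a (γ s)) (ht : l ≤ height w a (γ t)) : l ≤ height w a (γ r) := by
  have hst := hr.1.trans hr.2
  refine (le_min hs ht).trans (le_of_tendsto_of_tendsto
    ((tendsto_height hB ha (γ s)).min (tendsto_height hB ha (γ t)))
    (tendsto_height hB ha (γ r)) (Eventually.of_forall fun u => ?_))
  have hconv := hB.2 s t 0 0 γ (fun _ => a u) hγ (by
    intro x hx y hy
    rw [Icc_self, mem_singleton_iff] at hx hy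
    simp [hx, hy])
  have hconv' : ConvexOn ℝ (Icc s t) fun v => dist (γ v) (a u) := by
    refine ⟨convex_Icc s t, fun x hx y hy c d hc hd hcd => ?_⟩
    have := hconv.2 (x := (x, 0)) (y := (y, 0)) ⟨hx, by simp⟩ ⟨hy, by simp⟩ hc hd hcd
    simpa using this
  have := hconv'.le_max_of_mem_Icc ⟨le_rfl, hst⟩ ⟨hst, le_rfl⟩ hr
  simp only
  rcases le_max_iff.1 this with h | h
  · exact (min_le_left _ _).trans (by linarith)
  · exact (min_le_right _ _).trans (by linarith)

theorem IsGeodSegment.dist_add_dist {γ : ℝ → H} {x y u : H} (hγ : IsGeodSegment γ x y)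
    (hu : u ∈ γ '' Icc 0 (dist x y)) : dist x u + dist u y = dist x y := by
  obtain ⟨s, hs, rfl⟩ := hu
  have h0 : (0 : ℝ) ∈ Icc 0 (dist x y) := ⟨le_rfl, dist_nonneg⟩
  have h1 : dist x y ∈ Icc 0 (dist x y) := ⟨dist_nonneg, le_rfl⟩
  have e1 := hγ.1 0 h0 s hs
  have e2 := hγ.1 s hs _ h1
  rw [hγ.2.1, zero_sub, abs_neg, abs_of_nonneg hs.1] at e1
  rw [hγ.2.2, abs_sub_comm, abs_of_nonneg (sub_nonneg.2 hs.2)] at e2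
  linarith

/-- The four point condition for a space with `δ`-slim triangles. -/
theorem four_point {δ : ℝ} (hH : DeltaHyperbolic H δ) (x y z o : H) :
    dist x z - dist x o - dist z o ≤
      max (dist x y - dist x o - dist y o) (dist y z - dist y o - dist z o) + 6 * δ := by
  obtain ⟨γ, hγ⟩ := hH.1 x z
  obtain ⟨γzo, hzo⟩ := hH.1 z o
  obtain ⟨γox, hox⟩ := hH.1 o x
  obtain ⟨γzy, hzy⟩ := hH.1 z y
  obtain ⟨γyx, hyx⟩ := hH.1 y x
  have t1 := dist_triangle x z o
  have t2 := dist_triangle_left x z o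
  have t3 := dist_triangle_left z o x
  set s := (dist x o + dist x z - dist z o) / 2 with hs
  have hsm : s ∈ Icc 0 (dist x z) := by
    rw [dist_comm o x, dist_comm o z] at t2
    constructor <;> linarith
  have hw := hγ.dist_add_dist ⟨s, hsm, rfl⟩
  have hxw : dist x (γ s) = s := by
    have := hγ.1 0 ⟨le_rfl, dist_nonneg⟩ s hsm
    rwa [hγ.2.1, zero_sub, abs_neg, abs_of_nonneg hsm.1] at this
  have how : dist o (γ s) ≤ (dist x o + dist z o - dist x z) / 2 + 2 * δ := by
    obtain ⟨u, hu, hd⟩ := hH.2 x z o γ γzo γox hγ hzo hox s hsm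
    have d1 := dist_triangle_right o (γ s) u
    rcases hu with hu | hu
    · have d2 := hzo.dist_add_dist hu
      have d3 := dist_triangle_right (γ s) z u
      rw [dist_comm u o] at d2
      linarith
    · have d2 := hox.dist_add_dist hu
      have d3 := dist_triangle_right x (γ s) u
      rw [dist_comm u x, dist_comm o x] at d2
      linarith
  obtain ⟨u, hu, hd⟩ := hH.2 x z y γ γzy γyx hγ hzy hyx s hsm
  have d1 := dist_triangle o (γ s) u
  rcases hu with hu | hu
  · have d2 := hzy.dist_add_dist hu
    have d3 := dist_triangle_left z o u
    have d4 := dist_triangle y u o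
    rw [dist_comm u z, dist_comm u o] at d3
    rw [dist_comm u o, dist_comm y u] at d4
    rw [dist_comm z y] at d2
    linarith [le_max_right (dist x y - dist x o - dist y o) (dist y z - dist y o - dist z o)]
  · have d2 := hyx.dist_add_dist hu
    have d3 := dist_triangle x u o
    have d4 := dist_triangle y u o
    rw [dist_comm x u, dist_comm u o] at d3
    rw [dist_comm u o] at d4
    rw [dist_comm y x] at d2
    linarith [le_max_left (dist x y - dist x o - dist y o) (dist y z - dist y o - dist z o)]

/-- The four point condition at the boundary point. -/
theorem height_four_point {δ : ℝ} (hH : DeltaHyperbolic H δ) (hB : BusemannSpace H)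
    (ha : IsRayFrom w a) (x y z : H) :
    height w a x + height w a z + dist x z ≤
      max (height w a x + height w a y + dist x y) (height w a y + height w a z + dist y z)
        + 6 * δ := by
  have hx := tendsto_height hB ha x
  have hy := tendsto_height hB ha y
  have hz := tendsto_height hB ha z
  refine le_of_tendsto_of_tendsto ((hx.add hz).add_const _)
    ((((hx.add hy).add_const _).max ((hy.add hz).add_const _)).add_const _)
    (Eventually.of_forall fun t => ?_)
  have := four_point hH x y z (a t)
  simp only
  rcases le_total (dist x y - dist x (a t) - dist y (a t))
    (dist y z - dist y (a t) - dist z (a t)) with h | h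
  · rw [max_eq_right h] at this
    exact le_trans (by linarith) (add_le_add_left (le_max_right _ _) _)
  · rw [max_eq_left h] at this
    exact le_trans (by linarith) (add_le_add_left (le_max_left _ _) _)

/-- Every point lies on a vertical geodesic. -/
theorem exists_vertParam [ProperSpace H] (hB : BusemannSpace H) (hG : GeodesicallyComplete H)
    (ha : IsRayFrom w a) (x : H) : ∃ V, VertParam w a V ∧ V (height w a x) = x := by
  have key : ∀ n : ℕ, ∃ γ : ℝ → H, IsGeodesicLine γ ∧ γ 0 = x ∧ γ (dist x (a n)) = a n := by
    intro n
    obtain ⟨γ, hγ, h0, h1⟩ := hB.1 x (a n)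
    obtain ⟨γ', hγ', he⟩ := hG 0 _ γ dist_nonneg hγ
    exact ⟨γ', hγ', by rw [he 0 ⟨le_rfl, dist_nonneg⟩, h0],
      by rw [he _ ⟨dist_nonneg, le_rfl⟩, h1]⟩
  choose γ hγ h0 h1 using key
  have hlim : ∀ s : ℝ, ∃ v, Tendsto (fun n => γ n s) (hyperfilter ℕ) (nhds v) := by
    intro s
    obtain ⟨v, -, hv⟩ := (isCompact_closedBall x |s|).ultrafilter_le_nhds
      ((hyperfilter ℕ).map fun n => γ n s) (by
        rw [Ultrafilter.coe_map]
        refine tendsto_principal.2 (Eventually.of_forall fun n => ?_)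
        rw [Metric.mem_closedBall]
        have := hγ n s trivial 0 trivial
        rw [h0, sub_zero] at this
        exact this.le)
    exact ⟨v, hv⟩
  choose V hV using hlim
  have hVline : IsGeodesicLine V := fun s _ t _ =>
    tendsto_nhds_unique ((hV s).dist (hV t))
      (tendsto_const_nhds.congr fun n => (hγ n s trivial t trivial).symm)
  have hV0 : V 0 = x := tendsto_nhds_unique (hV 0) (tendsto_const_nhds.congr fun n => (h0 n).symm)
  have hcast : Tendsto (fun n : ℕ => (n : ℝ)) (hyperfilter ℕ) atTop :=
    tendsto_natCast_atTop_atTop.mono_left Nat.hyperfilter_le_atTop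
  have hVh : ∀ s, height w a (V s) = height w a x + s := by
    intro s
    have hx := (tendsto_height hB ha x).comp hcast
    have hVs := (tendsto_height hB ha (V s)).comp hcast
    have hd : Tendsto (fun n => dist (γ n s) (V s)) (hyperfilter ℕ) (nhds 0) :=
      tendsto_iff_dist_tendsto_zero.1 (hV s)
    have hfar : ∀ᶠ n : ℕ in hyperfilter ℕ, s ≤ dist x (a n) := by
      filter_upwards [hcast.eventually_ge_atTop (s + dist x w), hcast.eventually_ge_atTop 0]
        with n hn hn0
      have := dist_triangle_left w (a n) x
      rw [ha.dist_zero hn0] at this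
      linarith
    have hz : Tendsto (fun n : ℕ => ((n : ℝ) - dist (V s) (a n)) - (n - dist x (a n)) - s)
        (hyperfilter ℕ) (nhds 0) := by
      refine squeeze_zero_norm' ?_ hd
      filter_upwards [hfar] with n hn
      have e1 := hγ n s trivial (dist x (a n)) trivial
      rw [h1, abs_sub_comm, abs_of_nonneg (sub_nonneg.2 hn)] at e1
      have e2 := abs_dist_sub_le (γ n s) (V s) (a n)
      rw [e1] at e2
      rw [Real.norm_eq_abs]
      convert e2 using 2
      ring
    have := tendsto_nhds_unique hz ((hVs.sub hx).sub_const s)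
    linarith
  refine ⟨fun t => V (t - height w a x), ⟨fun s _ t _ => ?_, fun t => ?_⟩, ?_⟩
  · rw [hVline _ trivial _ trivial]; congr 1; ring
  · rw [hVh]; ring
  · simp [hV0]

theorem VertParam.dist_eq {V : ℝ → H} (hV : VertParam w a V) (s t : ℝ) :
    dist (V s) (V t) = |s - t| := hV.1 s trivial t trivial

/-- The vertical geodesic through `x` comes close to `y` at the height of `y`, provided that
`dist x y` is close to the height difference. -/
theorem VertParam.dist_le {δ : ℝ} (hδ : 0 ≤ δ) (hH : DeltaHyperbolic H δ) (hB : BusemannSpace H)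
    (ha : IsRayFrom w a) {V : ℝ → H} (hV : VertParam w a V) {x : H} (hx : V (height w a x) = x)
    (y : H) :
    dist (V (height w a y)) y ≤ dist x y - (height w a y - height w a x) + 6 * δ := by
  have h1 := hV.dist_eq (height w a y) (height w a x)
  rw [hx] at h1
  have h2 := height_sub_le hB ha x y
  rcases le_total (height w a x) (height w a y) with h | h
  · have h3 := height_four_point hH hB ha (V (height w a y)) x y
    rw [hV.2, h1, abs_of_nonneg (sub_nonneg.2 h)] at h3
    have h4 := (neg_le_abs _).trans h2
    have h5 : max (height w a y + height w a x + (height w a y - height w a x))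
        (height w a x + height w a y + dist x y) ≤
        height w a x + height w a y + dist x y := max_le (by linarith) le_rfl
    linarith
  · have h3 := dist_triangle (V (height w a y)) x y
    rw [h1, abs_of_nonpos (sub_nonpos.2 h)] at h3
    linarith

end Factor

namespace AdmNorm

variable (N : AdmNorm)

/-- The cost of a horizontal displacement in the first factor. -/
def costLeft : ℝ := max 1 (N.toFun (1, 0))

/-- The cost of a horizontal displacement in the second factor. -/
def costRight : ℝ := max 1 (N.toFun (0, 1))

theorem diag {m : ℝ} (hm : 0 ≤ m) : N.toFun (m, m) = m := by
  have := N.smul_eq m (1, 1)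
  simpa [N.one_one, abs_of_nonneg hm] using this

theorem le_cost {m x y : ℝ} (hm : 0 ≤ m) (hx : m ≤ x) (hy : m ≤ y) :
    N.toFun (x, y) ≤ m + N.costLeft * (x - m) + N.costRight * (y - m) := by
  have e : ((x, y) : ℝ × ℝ) = (m, m) + ((x - m) • (1, 0) + (y - m) • (0, 1)) := by
    ext <;> simp
  have h1 := N.add_le (m, m) ((x - m) • (1, 0) + (y - m) • (0, 1))
  have h2 := N.add_le ((x - m) • (1, 0)) ((y - m) • (0, 1))
  rw [← e, N.diag hm] at h1
  rw [N.smul_eq, N.smul_eq, abs_of_nonneg (sub_nonneg.2 hx), abs_of_nonneg (sub_nonneg.2 hy)] at h2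
  have h3 := mul_le_mul_of_nonneg_left (le_max_right 1 (N.toFun (1, 0))) (sub_nonneg.2 hx)
  have h4 := mul_le_mul_of_nonneg_left (le_max_right 1 (N.toFun (0, 1))) (sub_nonneg.2 hy)
  rw [costLeft, costRight]
  linarith

theorem le_cost_of_le {m x y x' y' : ℝ} (hm : 0 ≤ m) (hx : m ≤ x) (hx' : x ≤ x') (hy : m ≤ y)
    (hy' : y ≤ y') : N.toFun (x, y) ≤ m + N.costLeft * (x' - m) + N.costRight * (y' - m) := by
  have h1 : 0 ≤ N.costLeft := zero_le_one.trans (le_max_left _ _)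
  have h2 : 0 ≤ N.costRight := zero_le_one.trans (le_max_left _ _)
  refine (N.le_cost hm hx hy).trans ?_
  gcongr

variable {N}

theorem BoundConst.costLeft_mem {C : ℝ} (hC : N.BoundConst C) : N.costLeft ∈ Icc 1 C := by
  refine ⟨le_max_left _ _, max_le hC.1 ?_⟩
  linarith [hC.2 1 0 zero_le_one le_rfl, hC.1]

theorem BoundConst.costRight_mem {C : ℝ} (hC : N.BoundConst C) : N.costRight ∈ Icc 1 C := by
  refine ⟨le_max_left _ _, max_le hC.1 ?_⟩
  linarith [hC.2 0 1 le_rfl zero_le_one, hC.1]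

theorem BoundConst.costLeft_mul_le {C x y : ℝ} (hC : N.BoundConst C) (hx : 0 ≤ x) (hy : 0 ≤ y) :
    N.costLeft = 1 ∨ N.costLeft * x ≤ N.toFun (x, y) + C * y := by
  rcases le_total (N.toFun (1, 0)) 1 with h | h
  · exact Or.inl (max_eq_left h)
  · right
    have h1 := N.add_le (x, y) ((-y) • (0, 1))
    have h2 := N.smul_eq x (1, 0)
    rw [N.smul_eq, abs_neg, abs_of_nonneg hy] at h1
    rw [abs_of_nonneg hx] at h2
    simp only [Prod.smul_mk, smul_eq_mul, mul_zero, mul_one, Prod.mk_add_mk, add_zero,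
      add_neg_cancel] at h1 h2
    have h3 := mul_le_mul_of_nonneg_left (hC.2 0 1 le_rfl zero_le_one) hy
    rw [costLeft, max_eq_right h]
    nlinarith [mul_nonneg hy (zero_le_one.trans hC.1)]

theorem BoundConst.costRight_mul_le {C x y : ℝ} (hC : N.BoundConst C) (hx : 0 ≤ x) (hy : 0 ≤ y) :
    N.costRight = 1 ∨ N.costRight * y ≤ N.toFun (x, y) + C * x := by
  rcases le_total (N.toFun (0, 1)) 1 with h | h
  · exact Or.inl (max_eq_left h)
  · right
    have h1 := N.add_le (x, y) ((-x) • (1, 0))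
    have h2 := N.smul_eq y (0, 1)
    rw [N.smul_eq, abs_neg, abs_of_nonneg hx] at h1
    rw [abs_of_nonneg hy] at h2
    simp only [Prod.smul_mk, smul_eq_mul, mul_zero, mul_one, Prod.mk_add_mk, add_zero,
      add_neg_cancel] at h1 h2
    have h3 := mul_le_mul_of_nonneg_left (hC.2 1 0 zero_le_one le_rfl) hx
    rw [costRight, max_eq_right h]
    nlinarith [mul_nonneg hx (zero_le_one.trans hC.1)]

end AdmNorm

section Product

theorem ofReal_le_dHN (Nf : ℝ × ℝ → ℝ) (mem : Hp × Hq → Prop) (x y : Hp × Hq) :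
    ENNReal.ofReal (Nf (dist x.1 y.1, dist x.2 y.2)) ≤ dHN Nf mem x y := by
  refine le_iInf fun T => le_iInf fun hT => le_iInf fun γ => le_iInf fun _ => le_iInf fun _ =>
    le_iInf fun h0 => le_iInf fun h1 => ?_
  have hu : Monotone (fun i : ℕ => if i = 0 then 0 else T) := by
    intro i j hij
    dsimp only
    split_ifs <;> first | omega | exact le_rfl
  refine le_trans ?_ (le_iSup _ (⟨1, ⟨_, hu, fun i => ?_⟩⟩ :
    ℕ × { u : ℕ → ℝ // Monotone u ∧ ∀ i, u i ∈ Icc 0 T }))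
  · simp [h0, h1, dist_comm]
  · split_ifs <;> simp [hT]

/-- A path whose increments are controlled by the increments of `F` bounds the `N`-distance
between its end points. -/
theorem dHN_le_of_increments (N : AdmNorm) {mem : Hp × Hq → Prop} {s₀ s₁ : ℝ} (hs : s₀ ≤ s₁)
    {γ : ℝ → Hp × Hq} {F : ℝ → ℝ} (hF : Continuous F) (hmem : ∀ t ∈ Icc s₀ s₁, mem (γ t))
    (hinc : ∀ s ∈ Icc s₀ s₁, ∀ t ∈ Icc s₀ s₁, s ≤ t →
      N.toFun (dist (γ t).1 (γ s).1, dist (γ t).2 (γ s).2) ≤ F t - F s) :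
    dHN N.toFun mem (γ s₀) (γ s₁) ≤ ENNReal.ofReal (F s₁ - F s₀) := by
  have hadm : ∀ s ∈ Icc s₀ s₁, ∀ t ∈ Icc s₀ s₁, s ≤ t → dist (γ t) (γ s) ≤ 2 * (F t - F s) := by
    intro s hs t ht hst
    have h1 := (N.adm _ _).trans (hinc s hs t ht hst)
    have h2 : dist (γ t) (γ s) ≤ dist (γ t).1 (γ s).1 + dist (γ t).2 (γ s).2 :=
      max_le (le_add_of_nonneg_right dist_nonneg) (le_add_of_nonneg_left dist_nonneg)
    linarith
  have hmono : ∀ s ∈ Icc s₀ s₁, ∀ t ∈ Icc s₀ s₁, s ≤ t → F s ≤ F t := fun s hs t ht hst => by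
    linarith [hadm s hs t ht hst, dist_nonneg (x := γ t) (y := γ s)]
  have hcont : ContinuousOn γ (Icc s₀ s₁) := by
    intro s hs
    refine tendsto_iff_dist_tendsto_zero.2 (squeeze_zero' (Eventually.of_forall fun t => dist_nonneg)
      (g := fun t => 2 * |F t - F s|) ?_ ?_)
    · filter_upwards [self_mem_nhdsWithin] with t ht
      rcases le_total s t with h | h
      · exact (hadm s hs t ht h).trans (by gcongr; exact le_abs_self _)
      · rw [dist_comm]
        refine (hadm t ht s hs h).trans ?_
        rw [abs_sub_comm]
        gcongr
        exact le_abs_self _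
    · have : ContinuousWithinAt (fun t => 2 * |F t - F s|) (Icc s₀ s₁) s :=
        (by fun_prop : Continuous fun t => 2 * |F t - F s|).continuousWithinAt
      simpa [ContinuousWithinAt] using this
  have hshift : ∀ t ∈ Icc 0 (s₁ - s₀), s₀ + t ∈ Icc s₀ s₁ := fun t ht =>
    ⟨by linarith [ht.1], by linarith [ht.2]⟩
  have hle : dHN N.toFun mem (γ s₀) (γ s₁) ≤
      lN N.toFun (fun t => γ (s₀ + t)) (Icc 0 (s₁ - s₀)) := by
    have hcont' : ContinuousOn (fun t => γ (s₀ + t)) (Icc 0 (s₁ - s₀)) :=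
      hcont.comp (by fun_prop) hshift
    unfold dHN
    exact iInf_le_of_le (s₁ - s₀) <| iInf_le_of_le (sub_nonneg.2 hs) <|
      iInf_le_of_le (fun t => γ (s₀ + t)) <| iInf_le_of_le hcont' <|
      iInf_le_of_le (fun t ht => hmem _ (hshift t ht)) <|
      iInf_le_of_le (by simp) <| iInf_le_of_le (by simp) le_rfl
  refine hle.trans (iSup_le fun ⟨n, u, hu, hu'⟩ => ?_)
  dsimp only
  calc _ ≤ ∑ i ∈ Finset.range n, ENNReal.ofReal (F (s₀ + u (i + 1)) - F (s₀ + u i)) :=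
        Finset.sum_le_sum fun i _ => ENNReal.ofReal_le_ofReal
          (hinc _ (hshift _ (hu' i)) _ (hshift _ (hu' _)) (by linarith [hu (Nat.le_succ i)]))
    _ = ENNReal.ofReal (∑ i ∈ Finset.range n, (F (s₀ + u (i + 1)) - F (s₀ + u i))) :=
        (ENNReal.ofReal_sum_of_nonneg fun i _ => sub_nonneg.2
          (hmono _ (hshift _ (hu' i)) _ (hshift _ (hu' _)) (by linarith [hu (Nat.le_succ i)]))).symm
    _ ≤ ENNReal.ofReal (F s₁ - F s₀) := by
        refine ENNReal.ofReal_le_ofReal ?_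
        rw [Finset.sum_range_sub fun i => F (s₀ + u i)]
        have h1 := hmono _ (hshift _ (hu' n)) _ ⟨hs, le_rfl⟩ (hshift _ (hu' n)).2
        have h2 := hmono _ ⟨le_rfl, hs⟩ _ (hshift _ (hu' 0)) (hshift _ (hu' 0)).1
        linarith

theorem dHN_le_of_increments_symm (N : AdmNorm) {mem : Hp × Hq → Prop} {s₀ s₁ : ℝ} (hs : s₀ ≤ s₁)
    {γ : ℝ → Hp × Hq} {F : ℝ → ℝ} (hF : Continuous F) (hmem : ∀ t ∈ Icc s₀ s₁, mem (γ t))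
    (hinc : ∀ s ∈ Icc s₀ s₁, ∀ t ∈ Icc s₀ s₁, s ≤ t →
      N.toFun (dist (γ t).1 (γ s).1, dist (γ t).2 (γ s).2) ≤ F t - F s) :
    dHN N.toFun mem (γ s₁) (γ s₀) ≤ ENNReal.ofReal (F s₁ - F s₀) := by
  have hneg : ∀ t ∈ Icc (-s₁) (-s₀), -t ∈ Icc s₀ s₁ := fun t ht =>
    ⟨by linarith [ht.2], by linarith [ht.1]⟩
  have := dHN_le_of_increments N (neg_le_neg hs) (γ := fun t => γ (-t)) (F := fun t => -F (-t))
    (by fun_prop) (fun t ht => hmem _ (hneg t ht)) (fun s hs t ht hst => by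
      have := hinc _ (hneg t ht) _ (hneg s hs) (neg_le_neg hst)
      rw [dist_comm, dist_comm (γ (-t)).2]
      linarith)
  simp only [neg_neg] at this
  rwa [show -F s₀ - -F s₁ = F s₁ - F s₀ by ring] at this

/-- A pair of vertical geodesics of the factors, parametrised by opposite heights, is a vertical
geodesic of the horospherical product. -/
theorem VertParam.isHNVerticalLine (N : AdmNorm) {wp : Hp} {ap : ℝ → Hp} {wq : Hq} {aq : ℝ → Hq}
    {Vp : ℝ → Hp} {Vq : ℝ → Hq} (hp : VertParam wp ap Vp) (hq : VertParam wq aq Vq) :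
    IsHNVerticalLine N.toFun (inHoro wp ap wq aq) wp ap fun t => (Vp t, Vq (-t)) := by
  have hmem : ∀ t : ℝ, inHoro wp ap wq aq (Vp t, Vq (-t)) := fun t => by
    simp [inHoro, hp.2, hq.2]
  have hd : ∀ s t : ℝ, N.toFun (dist (Vp s) (Vp t), dist (Vq (-s)) (Vq (-t))) = |s - t| := by
    intro s t
    rw [hp.dist_eq, hq.dist_eq, show -s - -t = t - s by ring, abs_sub_comm t s,
      N.diag (abs_nonneg _)]
  refine ⟨⟨fun t _ => hmem t, fun s _ t _ => le_antisymm ?_ ?_⟩, fun t => hp.2 t⟩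
  · have hinc : ∀ s t : ℝ, s ≤ t →
        N.toFun (dist (Vp t) (Vp s), dist (Vq (-t)) (Vq (-s))) ≤ id t - id s := fun s t h => by
      rw [hd, abs_of_nonneg (sub_nonneg.2 h)]; rfl
    rcases le_total s t with h | h
    · rw [abs_sub_comm, abs_of_nonneg (sub_nonneg.2 h)]
      exact dHN_le_of_increments N h (γ := fun t => (Vp t, Vq (-t))) continuous_id
        (fun t _ => hmem t) fun s _ t _ => hinc s t
    · rw [abs_of_nonneg (sub_nonneg.2 h)]
      exact dHN_le_of_increments_symm N h (γ := fun t => (Vp t, Vq (-t))) continuous_id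
        (fun t _ => hmem t) fun s _ t _ => hinc s t
  · rw [← hd]
    exact ofReal_le_dHN N.toFun (inHoro wp ap wq aq) (Vp s, Vq (-s)) (Vp t, Vq (-t))

end Product

/-- A factor of a horospherical product: a `δ`-hyperbolic, Busemann, geodesically complete space
with a ray representing the chosen boundary point. -/
structure HoroFactor (δ : ℝ) (w : H) (a : ℝ → H) : Prop where
  hyp : DeltaHyperbolic H δ
  bus : BusemannSpace H
  compl : GeodesicallyComplete H
  ray : IsRayFrom w a

theorem HoroFactor.exists_line {δ : ℝ} {w : H} {a : ℝ → H} (P : HoroFactor δ w a) (x y : H)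
    (c : ℝ) : ∃ g : ℝ → H, IsGeodesicLine g ∧ g c = x ∧ g (c + dist x y) = y := by
  obtain ⟨γ, hγ, h0, h1⟩ := P.bus.1 x y
  obtain ⟨γ', hγ', he⟩ := P.compl 0 _ γ dist_nonneg hγ
  refine ⟨fun t => γ' (t - c), fun s _ t _ => ?_, ?_, ?_⟩
  · rw [hγ' _ trivial _ trivial]; congr 1; ring
  · simp [he 0 ⟨le_rfl, dist_nonneg⟩, h0]
  · simp [he _ ⟨dist_nonneg, le_rfl⟩, h1]

section Product

variable {δ : ℝ} {wp : Hp} {ap : ℝ → Hp} {wq : Hq} {aq : ℝ → Hq}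

/-- Two points of the horospherical product are joined by a path following first a geodesic of the
second factor, then a vertical geodesic, then a geodesic of the first factor. -/
theorem exists_path [ProperSpace Hp] [ProperSpace Hq] (hδ : 0 ≤ δ) (P : HoroFactor δ wp ap)
    (Q : HoroFactor δ wq aq) (N : AdmNorm) {x y : Hp × Hq}
    (hx : inHoro wp ap wq aq x) (hy : inHoro wp ap wq aq y)
    (hxy : height wp ap x.1 ≤ height wp ap y.1) :
    ∃ (s₀ s₁ : ℝ) (γ : ℝ → Hp × Hq) (F : ℝ → ℝ), s₀ ≤ s₁ ∧ Continuous F ∧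
      (∀ t ∈ Icc s₀ s₁, inHoro wp ap wq aq (γ t)) ∧
      (∀ s ∈ Icc s₀ s₁, ∀ t ∈ Icc s₀ s₁, s ≤ t →
        N.toFun (dist (γ t).1 (γ s).1, dist (γ t).2 (γ s).2) ≤ F t - F s) ∧
      γ s₀ = x ∧ γ s₁ = y ∧
      F s₁ - F s₀ ≤ (height wp ap y.1 - height wp ap x.1) +
        N.costLeft * (dist x.1 y.1 - (height wp ap y.1 - height wp ap x.1) + 6 * δ) +
        N.costRight * (dist x.2 y.2 - (height wp ap y.1 - height wp ap x.1) + 6 * δ) := by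
  obtain ⟨A, hA, hAx⟩ := exists_vertParam P.bus P.compl P.ray x.1
  obtain ⟨B, hB, hBy⟩ := exists_vertParam Q.bus Q.compl Q.ray y.2
  have hAl := hA.dist_le hδ P.hyp P.bus P.ray hAx y.1
  have hBl := hB.dist_le hδ Q.hyp Q.bus Q.ray hBy x.2
  have hx2 : height wq aq x.2 = -height wp ap x.1 := by rw [inHoro] at hx; linarith
  have hy2 : height wq aq y.2 = -height wp ap y.1 := by rw [inHoro] at hy; linarith
  rw [hx2, hy2, dist_comm y.2] at hBl
  rw [hy2] at hBy
  set u := height wp ap x.1 with hu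
  set v := height wp ap y.1 with hv
  set ℓ := dist x.2 (B (-u)) with hℓ
  set m := dist (A v) y.1 with hm
  have hℓ0 : 0 ≤ ℓ := dist_nonneg
  have hm0 : 0 ≤ m := dist_nonneg
  obtain ⟨g, hg, hg0, hg1⟩ := Q.exists_line x.2 (B (-u)) (u - ℓ)
  obtain ⟨f, hf, hf0, hf1⟩ := P.exists_line (A v) y.1 v
  rw [← hℓ, sub_add_cancel] at hg1
  rw [← hm] at hf1
  have hnp : 1 ≤ N.costLeft := le_max_left _ _
  have hnq : 1 ≤ N.costRight := le_max_left _ _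
  -- the heights along `g` and `f`
  set k : ℝ → ℝ := fun t => -height wq aq (g t) with hk
  set j : ℝ → ℝ := fun t => height wp ap (f t) with hj
  have hku : k u = u := by simp [hk, hg1, hB.2]
  have hjv : j v = v := by simp [hj, hf0, hA.2]
  have hkle : ∀ t ∈ Icc (u - ℓ) u, k t ≤ u := by
    intro t ht
    have := le_height_of_isGeodesicOn Q.bus Q.ray (γ := g) (l := -u)
      (fun a _ b _ => hg a trivial b trivial) ht (by rw [hg0, hx2]) (by rw [hg1, hB.2])
    simp only [hk]
    linarith
  have hjge : ∀ t ∈ Icc v (v + m), v ≤ j t := by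
    intro t ht
    exact le_height_of_isGeodesicOn P.bus P.ray (γ := f)
      (fun a _ b _ => hf a trivial b trivial) ht (by rw [hf0, hA.2]) (by rw [hf1])
  have hdg : ∀ s t, s ≤ t → dist (g t) (g s) = t - s := fun s t h => by
    rw [hg t trivial s trivial, abs_of_nonneg (sub_nonneg.2 h)]
  have hdf : ∀ s t, s ≤ t → dist (f t) (f s) = t - s := fun s t h => by
    rw [hf t trivial s trivial, abs_of_nonneg (sub_nonneg.2 h)]
  let γ : ℝ → Hp × Hq := fun t =>
    if t ≤ u then (A (k t), g t) else if t ≤ v then (A t, B (-t)) else (f t, B (-j t))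
  have hγ1 : ∀ t, t ≤ u → γ t = (A (k t), g t) := fun t ht => if_pos ht
  have hγ2 : ∀ t, u ≤ t → t ≤ v → γ t = (A t, B (-t)) := by
    intro t h1 h2
    rcases h1.eq_or_lt with rfl | h1
    · rw [hγ1 _ le_rfl, hku, hg1]
    · simp only [γ]; rw [if_neg h1.not_ge, if_pos h2]
  have hγ3 : ∀ t, v ≤ t → γ t = (f t, B (-j t)) := by
    intro t h1
    rcases h1.eq_or_lt with h1 | h1
    · rw [← h1, hγ2 _ hxy le_rfl, hjv, hf0]
    · simp only [γ]; rw [if_neg (hxy.trans_lt h1).not_ge, if_neg h1.not_ge]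
  let F : ℝ → ℝ := fun t =>
    N.costRight * min t u + min (max t u) v + N.costLeft * max t v
  have hF1 : ∀ t, t ≤ u → F t = N.costRight * t + u + N.costLeft * v := fun t ht => by
    simp only [F]; rw [min_eq_left ht, max_eq_right ht, min_eq_left hxy, max_eq_right (ht.trans hxy)]
  have hF2 : ∀ t, u ≤ t → t ≤ v → F t = N.costRight * u + t + N.costLeft * v := fun t h1 h2 => by
    simp only [F]; rw [min_eq_right h1, max_eq_left h1, min_eq_left h2, max_eq_right h2]
  have hF3 : ∀ t, v ≤ t → F t = N.costRight * u + v + N.costLeft * t := fun t h => by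
    simp only [F]
    rw [min_eq_right (hxy.trans h), max_eq_left (hxy.trans h), min_eq_right h, max_eq_left h]
  have hmem : ∀ t, inHoro wp ap wq aq (γ t) := by
    intro t
    rw [inHoro]
    rcases le_total t u with h1 | h1
    · rw [hγ1 t h1]; simp [hA.2, hk]
    rcases le_total t v with h2 | h2
    · rw [hγ2 t h1 h2]; simp [hA.2, hB.2]
    · rw [hγ3 t h2]; simp [hB.2, hj]
  have hmem_height : ∀ z z' : Hp × Hq, inHoro wp ap wq aq z → inHoro wp ap wq aq z' →
      height wp ap z.1 - height wp ap z'.1 ≤ dist z.1 z'.1 ∧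
      height wp ap z.1 - height wp ap z'.1 ≤ dist z.2 z'.2 := by
    intro z z' hz hz'
    rw [inHoro] at hz hz'
    have h1 := (le_abs_self _).trans (height_sub_le P.bus P.ray z.1 z'.1)
    have h2 := (neg_le_abs _).trans (height_sub_le Q.bus Q.ray z.2 z'.2)
    exact ⟨h1, by linarith⟩
  refine ⟨u - ℓ, v + m, γ, F, by linarith, by fun_prop, fun t _ => hmem t, ?_, ?_, ?_, ?_⟩
  · intro s hs t ht hst
    have hh := hmem_height _ _ (hmem t) (hmem s)
    rcases le_total t u with htu | htu
    · have hsu := hst.trans htu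
      rw [hγ1 s hsu, hγ1 t htu, hF1 s hsu, hF1 t htu]
      have h1 := height_sub_le Q.bus Q.ray (g t) (g s)
      have h2 : |k t - k s| ≤ dist (g t) (g s) := by
        rw [← abs_neg]; convert h1 using 2; simp only [hk]; ring
      have := N.le_cost_of_le (abs_nonneg _) (hA.dist_eq (k t) (k s)).ge
        (hA.dist_eq (k t) (k s)).le h2 (hdg s t hst).le
      have h3 := mul_nonneg (sub_nonneg.2 hnq) (abs_nonneg (k t - k s))
      simp only
      linarith
    rcases le_total s u with hsu | hsu
    · have h1 := hkle s ⟨hs.1, hsu⟩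
      have h2 := mul_nonneg (sub_nonneg.2 hnq) (sub_nonneg.2 h1)
      have h3 := hdg s u hsu
      rcases le_total t v with htv | htv
      · rw [hγ1 s hsu, hγ2 t htu htv] at hh ⊢
        rw [hF1 s hsu, hF2 t htu htv]
        simp only [hA.2] at hh ⊢
        have h4 : dist (B (-t)) (g s) ≤ t - s := by
          have := dist_triangle (B (-t)) (B (-u)) (g s)
          rw [hB.dist_eq, ← hg1, h3, abs_of_nonpos (by linarith)] at this
          linarith
        have h5 : dist (A t) (A (k s)) ≤ t - k s := by
          rw [hA.dist_eq, abs_of_nonneg (by linarith)]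
        have := N.le_cost_of_le (by linarith) hh.1 h5 hh.2 h4
        linarith
      · have h6 := hjge t ⟨htv, ht.2⟩
        have h7 := mul_nonneg (sub_nonneg.2 hnp) (sub_nonneg.2 h6)
        rw [hγ1 s hsu, hγ3 t htv] at hh ⊢
        rw [hF1 s hsu, hF3 t htv]
        simp only [hA.2] at hh ⊢
        change j t - k s ≤ _ ∧ j t - k s ≤ _ at hh
        have h4 : dist (B (-j t)) (g s) ≤ j t - s := by
          have := dist_triangle (B (-j t)) (B (-u)) (g s)
          rw [hB.dist_eq, ← hg1, h3, abs_of_nonpos (by linarith)] at this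
          linarith
        have h5 : dist (f t) (A (k s)) ≤ t - k s := by
          have := dist_triangle (f t) (A v) (A (k s))
          rw [hA.dist_eq, ← hf0, hdf v t htv, abs_of_nonneg (by linarith)] at this
          linarith
        have := N.le_cost_of_le (by linarith) hh.1 h5 hh.2 h4
        linarith
    rcases le_total t v with htv | htv
    · have hsv := hst.trans htv
      rw [hγ2 s hsu hsv, hγ2 t htu htv, hF2 s hsu hsv, hF2 t htu htv]
      simp only [hA.dist_eq, hB.dist_eq]
      rw [show -t - -s = -(t - s) by ring, abs_neg, N.diag (abs_nonneg _),
        abs_of_nonneg (sub_nonneg.2 hst)]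
      linarith
    have h6 := hjge t ⟨htv, ht.2⟩
    have h7 := mul_nonneg (sub_nonneg.2 hnp) (sub_nonneg.2 h6)
    rcases le_total s v with hsv | hsv
    · rw [hγ2 s hsu hsv, hγ3 t htv] at hh ⊢
      rw [hF2 s hsu hsv, hF3 t htv]
      simp only [hA.2] at hh ⊢
      change j t - s ≤ _ ∧ j t - s ≤ _ at hh
      have h4 : dist (B (-j t)) (B (-s)) ≤ j t - s := by
        rw [hB.dist_eq, abs_of_nonpos (by linarith)]
        linarith
      have h5 : dist (f t) (A s) ≤ t - s := by
        have := dist_triangle (f t) (A v) (A s)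
        rw [hA.dist_eq, ← hf0, hdf v t htv, abs_of_nonneg (by linarith)] at this
        linarith
      have := N.le_cost_of_le (by linarith) hh.1 h5 hh.2 h4
      linarith
    · rw [hγ3 s hsv, hγ3 t htv, hF3 s hsv, hF3 t htv]
      have h1 : |j t - j s| ≤ dist (f t) (f s) := height_sub_le P.bus P.ray (f t) (f s)
      have h2 : dist (B (-j t)) (B (-j s)) = |j t - j s| := by
        rw [hB.dist_eq, ← abs_neg]; congr 1; ring
      have := N.le_cost_of_le (abs_nonneg _) h1 (hdf s t hst).le h2.ge h2.le
      have h3 := mul_nonneg (sub_nonneg.2 hnp) (abs_nonneg (j t - j s))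
      simp only
      linarith
  · rw [hγ1 _ (by linarith), hg0]
    simp only [hk, hg0, hx2, neg_neg, hAx]
  · rw [hγ3 _ (by linarith), hf1]
    simp only [hj, hf1, ← hv, hBy]
  · rw [hF1 (u - ℓ) (by linarith), hF3 (v + m) (by linarith)]
    have h1 := mul_le_mul_of_nonneg_left hAl (zero_le_one.trans hnp)
    have h2 := mul_le_mul_of_nonneg_left hBl (zero_le_one.trans hnq)
    rw [dist_comm, ← hℓ] at h2
    linarith

end Product

section Geodesic

variable {δ : ℝ} {wp : Hp} {ap : ℝ → Hp} {wq : Hq} {aq : ℝ → Hq} [ProperSpace Hp] [ProperSpace Hq]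

/-- The `N`-path metric is bounded above in terms of the distances in the factors. -/
theorem dHN_le (hδ : 0 ≤ δ) (P : HoroFactor δ wp ap) (Q : HoroFactor δ wq aq) {N : AdmNorm}
    {C : ℝ} (hC : N.BoundConst C) {x y : Hp × Hq} (hx : inHoro wp ap wq aq x)
    (hy : inHoro wp ap wq aq y) :
    dHN N.toFun (inHoro wp ap wq aq) x y ≤
      ENNReal.ofReal (|height wp ap y.1 - height wp ap x.1| +
        N.costLeft * (dist x.1 y.1 - |height wp ap y.1 - height wp ap x.1|) +
        N.costRight * (dist x.2 y.2 - |height wp ap y.1 - height wp ap x.1|) + 12 * δ * C) := by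
  have h1 := mul_le_mul_of_nonneg_right hC.costLeft_mem.2 hδ
  have h2 := mul_le_mul_of_nonneg_right hC.costRight_mem.2 hδ
  rcases le_total (height wp ap x.1) (height wp ap y.1) with h | h
  · obtain ⟨s₀, s₁, γ, F, hs, hF, hmem, hinc, rfl, rfl, hle⟩ := exists_path hδ P Q N hx hy h
    refine (dHN_le_of_increments N hs hF hmem hinc).trans (ENNReal.ofReal_le_ofReal ?_)
    rw [abs_of_nonneg (sub_nonneg.2 h)]
    linarith
  · obtain ⟨s₀, s₁, γ, F, hs, hF, hmem, hinc, rfl, rfl, hle⟩ := exists_path hδ P Q N hy hx h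
    refine (dHN_le_of_increments_symm N hs hF hmem hinc).trans (ENNReal.ofReal_le_ofReal ?_)
    rw [abs_of_nonpos (sub_nonpos.2 h), dist_comm (γ s₁).1, dist_comm (γ s₁).2]
    linarith

theorem IsHNGeodesicOn.coarseGeodesic (hδ : 1 ≤ δ) (P : HoroFactor δ wp ap)
    (Q : HoroFactor δ wq aq) {N : AdmNorm} {C : ℝ} (hC : N.BoundConst C) {L : ℝ}
    {α : ℝ → Hp × Hq} (hα : IsHNGeodesicOn N.toFun (inHoro wp ap wq aq) α (Icc 0 L)) :
    CoarseGeodesic N.costLeft N.costRight C δ L (fun t => height wp ap (α t).1)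
      (fun s t => dist (α s).1 (α t).1) (fun s t => dist (α s).2 (α t).2) := by
  have hq : ∀ t ∈ Icc 0 L, height wq aq (α t).2 = -height wp ap (α t).1 := fun t ht =>
    eq_neg_of_add_eq_zero_right (hα.1 t ht)
  have hp_le : ∀ s t, |height wp ap (α t).1 - height wp ap (α s).1| ≤ dist (α s).1 (α t).1 :=
    fun s t => by rw [dist_comm]; exact height_sub_le P.bus P.ray _ _
  have hq_le : ∀ s ∈ Icc 0 L, ∀ t ∈ Icc 0 L,
      |height wp ap (α t).1 - height wp ap (α s).1| ≤ dist (α s).2 (α t).2 := fun s hs t ht => by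
    have := height_sub_le Q.bus Q.ray (α s).2 (α t).2
    rwa [hq s hs, hq t ht, neg_sub_neg] at this
  have hN : ∀ s ∈ Icc 0 L, ∀ t ∈ Icc 0 L,
      N.toFun (dist (α s).1 (α t).1, dist (α s).2 (α t).2) ≤ |t - s| := fun s hs t ht => by
    have := ofReal_le_dHN N.toFun (inHoro wp ap wq aq) (α s) (α t)
    rwa [hα.2 s hs t ht, ENNReal.ofReal_le_ofReal_iff (abs_nonneg _), abs_sub_comm] at this
  refine ⟨hC.1, hδ, hC.costLeft_mem, hC.costRight_mem, fun s _ t _ => hp_le s t, hq_le,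
    fun s hs t ht => ?_, fun s hs t ht => ?_, fun s hs t ht => ?_, fun s hs t ht => ?_,
    fun r _ s _ t _ => height_four_point P.hyp P.bus P.ray _ _ _, fun r hr s hs t ht => ?_⟩
  · linarith [N.adm (dist (α s).1 (α t).1) (dist (α s).2 (α t).2), hN s hs t ht]
  · have h1 := dHN_le (zero_le_one.trans hδ) P Q hC (hα.1 s hs) (hα.1 t ht)
    have h2 := mul_nonneg (zero_le_one.trans hC.costLeft_mem.1) (sub_nonneg.2 (hp_le s t))
    have h3 := mul_nonneg (zero_le_one.trans hC.costRight_mem.1) (sub_nonneg.2 (hq_le s hs t ht))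
    have h4 : 0 ≤ 12 * δ * C := by nlinarith [hC.1]
    rwa [hα.2 s hs t ht, ENNReal.ofReal_le_ofReal_iff (by positivity), abs_sub_comm] at h1
  · exact (hC.costLeft_mul_le dist_nonneg dist_nonneg).imp_right fun h =>
      h.trans (add_le_add_left (hN s hs t ht) _)
  · exact (hC.costRight_mul_le dist_nonneg dist_nonneg).imp_right fun h =>
      h.trans (add_le_add_left (hN s hs t ht) _)
  · have := height_four_point Q.hyp Q.bus Q.ray (α r).2 (α s).2 (α t).2
    simpa only [hq r hr, hq s hs, hq t ht, ← sub_eq_add_neg] using this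

/-- A point `z` of the horospherical product lies close to the vertical geodesic whose components
pass through `u` and `v` when `z` lies coarsely vertically above `u` and `v` in the two factors. -/
theorem dHN_vert_le (hδ : 1 ≤ δ) (P : HoroFactor δ wp ap) (Q : HoroFactor δ wq aq) {N : AdmNorm}
    {C : ℝ} (hC : N.BoundConst C) {U : ℝ → Hp} {V : ℝ → Hq} (hU : VertParam wp ap U)
    (hV : VertParam wq aq V) {u : Hp} {v : Hq} (hu : U (height wp ap u) = u)
    (hv : V (height wq aq v) = v) {z : Hp × Hq} (hz : inHoro wp ap wq aq z)
    (h1 : dist u z.1 - (height wp ap z.1 - height wp ap u) ≤ 3800 * δ * C ^ 2)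
    (h2 : dist v z.2 - (height wq aq z.2 - height wq aq v) ≤ 3800 * δ * C ^ 2) :
    dHN N.toFun (inHoro wp ap wq aq) z (U (height wp ap z.1), V (-height wp ap z.1)) ≤
      ENNReal.ofReal (7624 * δ * C ^ 3) := by
  have hδ0 := zero_le_one.trans hδ
  have hC1 := hC.1
  have hz2 : height wq aq z.2 = -height wp ap z.1 := eq_neg_of_add_eq_zero_right hz
  have k1 := hU.dist_le hδ0 P.hyp P.bus P.ray hu z.1
  have k2 := hV.dist_le hδ0 Q.hyp Q.bus Q.ray hv z.2
  rw [hz2, dist_comm] at k2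
  rw [hz2] at h2
  rw [dist_comm] at k1
  refine (dHN_le hδ0 P Q hC hz (by simp [inHoro, hU.2, hV.2])).trans (ENNReal.ofReal_le_ofReal ?_)
  simp only [hU.2, sub_self, abs_zero, sub_zero, zero_add]
  have m1 := mul_le_mul hC.costLeft_mem.2
    (k1.trans (add_le_add_left h1 _)) dist_nonneg (zero_le_one.trans hC1)
  have m2 := mul_le_mul hC.costRight_mem.2
    (k2.trans (add_le_add_left h2 _)) dist_nonneg (zero_le_one.trans hC1)
  have hC3 : C ≤ C ^ 3 := le_self_pow₀ hC1 (by norm_num)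
  have := mul_le_mul_of_nonneg_left hC3 hδ0
  linarith

theorem exists_vertical_of_min_le_max (hδ : 1 ≤ δ) (P : HoroFactor δ wp ap)
    (Q : HoroFactor δ wq aq) {N : AdmNorm} {C : ℝ} (hC : N.BoundConst C) {L : ℝ}
    {α : ℝ → Hp × Hq} (hα : IsHNGeodesicOn N.toFun (inHoro wp ap wq aq) α (Icc 0 L))
    {tm tM : ℝ} (htm : 0 ≤ tm) (hm : tm ≤ tM) (htM : tM ≤ L)
    (hmin : ∀ r ∈ Icc 0 L, height wp ap (α tm).1 ≤ height wp ap (α r).1)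
    (hmax : ∀ r ∈ Icc 0 L, height wp ap (α r).1 ≤ height wp ap (α tM).1) :
    ∃ V₁ V₂ : ℝ → Hp × Hq, IsHNVerticalLine N.toFun (inHoro wp ap wq aq) wp ap V₁ ∧
      IsHNVerticalLine N.toFun (inHoro wp ap wq aq) wp ap V₂ ∧
      height wp ap (α 0).1 - height wp ap (α L).1 ≤ 612 * δ * C ^ 2 ∧
      ∀ s ∈ Icc 0 L, ∃ z ∈ range V₁ ∪ range (fun t : ℝ => ((V₁ t).1, (V₂ t).2)) ∪ range V₂,
        dHN N.toFun (inHoro wp ap wq aq) (α s) z ≤ ENNReal.ofReal (7624 * δ * C ^ 3) := by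
  have G := hα.coarseGeodesic hδ P Q hC
  have hq : ∀ t ∈ Icc 0 L, height wq aq (α t).2 = -height wp ap (α t).1 := fun t ht =>
    eq_neg_of_add_eq_zero_right (hα.1 t ht)
  have h0 : (0 : ℝ) ∈ Icc 0 L := ⟨le_rfl, by linarith⟩
  have hL : L ∈ Icc 0 L := ⟨by linarith, le_rfl⟩
  have hM : tM ∈ Icc 0 L := ⟨by linarith, htM⟩
  obtain ⟨U₁, hU₁, hu₁⟩ := exists_vertParam P.bus P.compl P.ray (α tm).1
  obtain ⟨U₂, hU₂, hu₂⟩ := exists_vertParam P.bus P.compl P.ray (α L).1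
  obtain ⟨W₁, hW₁, hw₁⟩ := exists_vertParam Q.bus Q.compl Q.ray (α 0).2
  obtain ⟨W₂, hW₂, hw₂⟩ := exists_vertParam Q.bus Q.compl Q.ray (α tM).2
  refine ⟨_, _, hU₁.isHNVerticalLine N hW₁, hU₂.isHNVerticalLine N hW₂,
    G.start_sub_end_le htm htM hm hmin hmax, fun s hs => ?_⟩
  rcases le_total s tm with h | h
  · obtain ⟨e1, e2⟩ := G.before_min htM hm hmin hmax ⟨hs.1, h⟩
    refine ⟨_, Or.inl (Or.inl ⟨height wp ap (α s).1, rfl⟩),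
      dHN_vert_le hδ P Q hC hU₁ hW₁ hu₁ hw₁ (hα.1 s hs) ?_ ?_⟩
    · rwa [dist_comm]
    · rw [hq s hs, hq 0 h0]; linarith
  rcases le_total s tM with h' | h'
  · obtain ⟨e1, e2⟩ := G.between htm htM hmin hmax ⟨h, h'⟩
    refine ⟨_, Or.inl (Or.inr ⟨height wp ap (α s).1, rfl⟩),
      dHN_vert_le hδ P Q hC hU₁ hW₂ hu₁ hw₂ (hα.1 s hs) e1 ?_⟩
    rw [hq s hs, hq tM hM, dist_comm]; linarith
  · obtain ⟨e1, e2⟩ := G.after_max htm hm hmin hmax ⟨h', hs.2⟩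
    refine ⟨_, Or.inr ⟨height wp ap (α s).1, rfl⟩,
      dHN_vert_le hδ P Q hC hU₂ hW₂ hu₂ hw₂ (hα.1 s hs) ?_ ?_⟩
    · rwa [dist_comm]
    · rw [hq s hs, hq tM hM]; linarith

theorem exists_vertical_of_max_le_min (hδ : 1 ≤ δ) (P : HoroFactor δ wp ap)
    (Q : HoroFactor δ wq aq) {N : AdmNorm} {C : ℝ} (hC : N.BoundConst C) {L : ℝ}
    {α : ℝ → Hp × Hq} (hα : IsHNGeodesicOn N.toFun (inHoro wp ap wq aq) α (Icc 0 L))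
    {tm tM : ℝ} (htM : 0 ≤ tM) (hm : tM ≤ tm) (htm : tm ≤ L)
    (hmin : ∀ r ∈ Icc 0 L, height wp ap (α tm).1 ≤ height wp ap (α r).1)
    (hmax : ∀ r ∈ Icc 0 L, height wp ap (α r).1 ≤ height wp ap (α tM).1) :
    ∃ V₁ V₂ : ℝ → Hp × Hq, IsHNVerticalLine N.toFun (inHoro wp ap wq aq) wp ap V₁ ∧
      IsHNVerticalLine N.toFun (inHoro wp ap wq aq) wp ap V₂ ∧
      height wp ap (α L).1 - height wp ap (α 0).1 ≤ 612 * δ * C ^ 2 ∧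
      ∀ s ∈ Icc 0 L, ∃ z ∈ range V₁ ∪ range (fun t : ℝ => ((V₂ t).1, (V₁ t).2)) ∪ range V₂,
        dHN N.toFun (inHoro wp ap wq aq) (α s) z ≤ ENNReal.ofReal (7624 * δ * C ^ 3) := by
  have G := (hα.coarseGeodesic hδ P Q hC).swap
  have hq : ∀ t ∈ Icc 0 L, height wq aq (α t).2 = -height wp ap (α t).1 := fun t ht =>
    eq_neg_of_add_eq_zero_right (hα.1 t ht)
  have hmin' : ∀ r ∈ Icc 0 L, -height wp ap (α tM).1 ≤ -height wp ap (α r).1 := fun r hr =>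
    neg_le_neg (hmax r hr)
  have hmax' : ∀ r ∈ Icc 0 L, -height wp ap (α r).1 ≤ -height wp ap (α tm).1 := fun r hr =>
    neg_le_neg (hmin r hr)
  have hL : L ∈ Icc 0 L := ⟨by linarith, le_rfl⟩
  have hM : tM ∈ Icc 0 L := ⟨htM, by linarith⟩
  obtain ⟨U₁, hU₁, hu₁⟩ := exists_vertParam P.bus P.compl P.ray (α 0).1
  obtain ⟨U₂, hU₂, hu₂⟩ := exists_vertParam P.bus P.compl P.ray (α tm).1
  obtain ⟨W₁, hW₁, hw₁⟩ := exists_vertParam Q.bus Q.compl Q.ray (α tM).2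
  obtain ⟨W₂, hW₂, hw₂⟩ := exists_vertParam Q.bus Q.compl Q.ray (α L).2
  refine ⟨_, _, hU₁.isHNVerticalLine N hW₁, hU₂.isHNVerticalLine N hW₂, ?_, fun s hs => ?_⟩
  · linarith [G.start_sub_end_le htM htm hm hmin' hmax']
  rcases le_total s tM with h | h
  · obtain ⟨e1, e2⟩ := G.before_min htm hm hmin' hmax' ⟨hs.1, h⟩
    refine ⟨_, Or.inl (Or.inl ⟨height wp ap (α s).1, rfl⟩),
      dHN_vert_le hδ P Q hC hU₁ hW₁ hu₁ hw₁ (hα.1 s hs) ?_ ?_⟩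
    · linarith
    · rwa [hq s hs, hq tM hM, dist_comm]
  rcases le_total s tm with h' | h'
  · obtain ⟨e1, e2⟩ := G.between htM htm hmin' hmax' ⟨h, h'⟩
    refine ⟨_, Or.inl (Or.inr ⟨height wp ap (α s).1, rfl⟩),
      dHN_vert_le hδ P Q hC hU₂ hW₁ hu₂ hw₁ (hα.1 s hs) ?_ ?_⟩
    · rw [dist_comm]; linarith
    · rwa [hq s hs, hq tM hM]
  · obtain ⟨e1, e2⟩ := G.after_max htM hm hmin' hmax' ⟨h', hs.2⟩
    refine ⟨_, Or.inr ⟨height wp ap (α s).1, rfl⟩,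
      dHN_vert_le hδ P Q hC hU₂ hW₂ hu₂ hw₂ (hα.1 s hs) ?_ ?_⟩
    · linarith
    · rwa [hq s hs, hq L hL, dist_comm]

end Geodesic

/-- A geodesic segment of the horospherical product is contained in
the `196C₀C_N`-neighbourhood of the union of two vertical geodesics and a third,
mixed, vertical geodesic. -/
theorem statement17 {Hp Hq : Type*} [MetricSpace Hp] [MetricSpace Hq]
    [ProperSpace Hp] [ProperSpace Hq]
    (δ : ℝ) (hδ : 1 ≤ δ)
    (hHp : DeltaHyperbolic Hp δ) (hHq : DeltaHyperbolic Hq δ)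
    (hBp : BusemannSpace Hp) (hBq : BusemannSpace Hq)
    (hGp : GeodesicallyComplete Hp) (hGq : GeodesicallyComplete Hq)
    (wp : Hp) (ap : ℝ → Hp) (hap : IsRayFrom wp ap)
    (wq : Hq) (aq : ℝ → Hq) (haq : IsRayFrom wq aq)
    (N : AdmNorm) (CN : ℝ) (hCN : N.BoundConst CN)
    (C₀ : ℝ) (hC₀ : C₀ = (2853 * δ * CN + 2 ^ (851:ℕ)) ^ 2)
    (x y : Hp × Hq) (hx : inHoro wp ap wq aq x) (hy : inHoro wp ap wq aq y)
    (L : ℝ) (hL : 0 ≤ L) (α : ℝ → Hp × Hq)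
    (hα : IsHNGeodesicOn N.toFun (inHoro wp ap wq aq) α (Set.Icc 0 L))
    (hα0 : α 0 = x) (hαL : α L = y) :
    ∃ V₁ V₂ : ℝ → Hp × Hq,
      IsHNVerticalLine N.toFun (inHoro wp ap wq aq) wp ap V₁ ∧
      IsHNVerticalLine N.toFun (inHoro wp ap wq aq) wp ap V₂ ∧
      (height wp ap x.1 ≤ height wp ap y.1 - 7 * C₀ →
        ∀ s ∈ Set.Icc (0:ℝ) L,
          ∃ z ∈ Set.range V₁ ∪ Set.range (fun t : ℝ => ((V₁ t).1, (V₂ t).2))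
              ∪ Set.range V₂,
            dHN N.toFun (inHoro wp ap wq aq) (α s) z
              ≤ ENNReal.ofReal (196 * C₀ * CN)) ∧
      (height wp ap y.1 + 7 * C₀ ≤ height wp ap x.1 →
        ∀ s ∈ Set.Icc (0:ℝ) L,
          ∃ z ∈ Set.range V₁ ∪ Set.range (fun t : ℝ => ((V₂ t).1, (V₁ t).2))
              ∪ Set.range V₂,
            dHN N.toFun (inHoro wp ap wq aq) (α s) z
              ≤ ENNReal.ofReal (196 * C₀ * CN)) ∧
      (|height wp ap x.1 - height wp ap y.1| ≤ 7 * C₀ →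
        (∀ s ∈ Set.Icc (0:ℝ) L,
          ∃ z ∈ Set.range V₁ ∪ Set.range (fun t : ℝ => ((V₁ t).1, (V₂ t).2))
              ∪ Set.range V₂,
            dHN N.toFun (inHoro wp ap wq aq) (α s) z
              ≤ ENNReal.ofReal (196 * C₀ * CN)) ∨
        (∀ s ∈ Set.Icc (0:ℝ) L,
          ∃ z ∈ Set.range V₁ ∪ Set.range (fun t : ℝ => ((V₂ t).1, (V₁ t).2))
              ∪ Set.range V₂,
            dHN N.toFun (inHoro wp ap wq aq) (α s) z
              ≤ ENNReal.ofReal (196 * C₀ * CN))) := by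
  subst hα0 hαL
  have P : HoroFactor δ wp ap := ⟨hHp, hBp, hGp, hap⟩
  have Q : HoroFactor δ wq aq := ⟨hHq, hBq, hGq, haq⟩
  have hC := hCN.1
  have hsq : (2853 * δ * CN) ^ 2 ≤ C₀ := by
    rw [hC₀]
    exact pow_le_pow_left₀ (by positivity) (le_add_of_nonneg_right (pow_pos two_pos _).le) 2
  have hδ2 : δ * CN ^ 2 ≤ δ ^ 2 * CN ^ 2 :=
    mul_le_mul_of_nonneg_right (le_self_pow₀ hδ two_ne_zero) (by positivity)
  have hgap : 612 * δ * CN ^ 2 < 7 * C₀ := by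
    nlinarith [mul_pos (zero_lt_one.trans_le hδ) (pow_pos (zero_lt_one.trans_le hC) 2)]
  have hnear : ENNReal.ofReal (7624 * δ * CN ^ 3) ≤ ENNReal.ofReal (196 * C₀ * CN) := by
    refine ENNReal.ofReal_le_ofReal ?_
    have h1 : 7624 * δ * CN ^ 2 ≤ 196 * C₀ := by nlinarith [sq_nonneg (δ * CN)]
    have h2 := mul_le_mul_of_nonneg_right h1 (zero_le_one.trans hC)
    linarith
  have hcont := (hα.coarseGeodesic hδ P Q hCN).continuousOn
  have hne : (Icc 0 L).Nonempty := ⟨0, le_rfl, hL⟩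
  obtain ⟨tm, htm, hmin⟩ := isCompact_Icc.exists_isMinOn hne hcont
  obtain ⟨tM, htM, hmax⟩ := isCompact_Icc.exists_isMaxOn hne hcont
  rcases le_total tm tM with h | h
  · obtain ⟨V₁, V₂, hV₁, hV₂, hd, hnb⟩ := exists_vertical_of_min_le_max hδ P Q hCN hα htm.1 h htM.2
      (fun r hr => hmin hr) (fun r hr => hmax hr)
    have hnb' := fun s hs => (hnb s hs).imp fun z => And.imp_right fun hz => hz.trans hnear
    exact ⟨V₁, V₂, hV₁, hV₂, fun _ => hnb', fun hh => by linarith, fun _ => Or.inl hnb'⟩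
  · obtain ⟨V₁, V₂, hV₁, hV₂, hd, hnb⟩ := exists_vertical_of_max_le_min hδ P Q hCN hα htM.1 h htm.2
      (fun r hr => hmin hr) (fun r hr => hmax hr)
    have hnb' := fun s hs => (hnb s hs).imp fun z => And.imp_right fun hz => hz.trans hnear
    exact ⟨V₁, V₂, hV₁, hV₂, fun hh => by linarith, fun _ => hnb', fun _ => Or.inr hnb'⟩

end HP

end
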